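/- arXiv:hep-th/9808193 — 5 statements merged into one kernel-verified Lean document; each statement's English description precedes it below -/
import Mathlib

section
/- Fix an integer d ≥ 1 and real numbers s, t with s > t/2 > 0. Let p be a polynomial in d variables with complex coefficients, homogeneous of degree n, and let q = e^{(t−s)Δ/2}p. Then for every z ∈ ℂ^d, S_{s,t}(e^{−sΔ/2}p)(z) = ∫_{ℝ^d} P_t(z − x)·(e^{−sΔ/2}p)(x) dx = q_ℂ(z), where q_ℂ is the evaluation of the polynomial q at the complex point z. (This is Theorem 3.8: S_{s,t}(e^{−sΔ/2}p) = e^{−A_{s,t}/2}(p_ℂ), since A_{s,t} agrees with (s−t)Δ on analytic continuations of polynomials.) -/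
open MeasureTheory

noncomputable section

/-- The Gaussian density `P_s(x) = (2πs)^{-d/2} exp(-|x|²/(2s))` on `ℝ^d`. -/
def gaussDensity (d : ℕ) (s : ℝ) (x : Fin d → ℝ) : ℝ :=
  (2 * Real.pi * s) ^ (-(d : ℝ) / 2) * Real.exp (-(∑ i, x i ^ 2) / (2 * s))

/-- The Gaussian measure `P_s` on `ℝ^d`. -/
def gaussMeasure (d : ℕ) (s : ℝ) : Measure (Fin d → ℝ) :=
  volume.withDensity fun x => ENNReal.ofReal (gaussDensity d s x)

/-- The analytic continuation `P_t(z) = (2πt)^{-d/2} exp(-(z₁² + ⋯ + z_d²)/(2t))` of the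
Gaussian density to `ℂ^d`. -/
def heatKernelC (d : ℕ) (t : ℝ) (z : Fin d → ℂ) : ℂ :=
  (((2 * Real.pi * t) ^ (-(d : ℝ) / 2) : ℝ) : ℂ) * Complex.exp (-(∑ i, z i ^ 2) / (2 * t))

/-- The inclusion of `ℝ^d` into `ℂ^d`. -/
def coeRC (d : ℕ) (x : Fin d → ℝ) : Fin d → ℂ := fun i => (x i : ℂ)

/-- The Laplacian `Δ = Σ_j ∂²/∂x_j²` acting on polynomials. -/
def mvLaplacian (d : ℕ) (p : MvPolynomial (Fin d) ℂ) : MvPolynomial (Fin d) ℂ :=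
  ∑ j : Fin d, MvPolynomial.pderiv j (MvPolynomial.pderiv j p)

/-- The heat operator `e^{cΔ/2}` on polynomials, given by the finite sum
`Σ_k (c/2)^k Δ^k p / k!` (which terminates since `Δ^k p = 0` once `2k` exceeds the degree). -/
def heatOp (d : ℕ) (c : ℝ) (p : MvPolynomial (Fin d) ℂ) : MvPolynomial (Fin d) ℂ :=
  ∑ k ∈ Finset.range (p.totalDegree + 1),
    (((c : ℂ) / 2) ^ k / (Nat.factorial k : ℂ)) • (mvLaplacian d)^[k] p

/-- Evaluation of a complex polynomial at a real point of `ℝ^d`. -/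
def evalR (d : ℕ) (p : MvPolynomial (Fin d) ℂ) (x : Fin d → ℝ) : ℂ :=
  MvPolynomial.eval (fun i => (x i : ℂ)) p

lemma MvPolynomial.pderiv_pderiv_comm {σ R : Type*} [CommRing R] (i j : σ)
    (p : MvPolynomial σ R) : pderiv i (pderiv j p) = pderiv j (pderiv i p) := by
  classical
  let D : σ → Derivation R (MvPolynomial σ R) (MvPolynomial σ R) := pderiv
  have h : ⁅D i, D j⁆ = 0 := by
    refine MvPolynomial.derivation_ext fun k => ?_
    simp [D, Derivation.commutator_apply, pderiv_X, Pi.single_apply, apply_ite]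
  simpa [D, Derivation.commutator_apply, sub_eq_zero] using congr($h p)

lemma MvPolynomial.totalDegree_pderiv_le {σ R : Type*} [CommSemiring R] (i : σ)
    (p : MvPolynomial σ R) : (pderiv i p).totalDegree ≤ p.totalDegree - 1 := by
  classical
  rw [totalDegree_eq]
  refine Finset.sup_le fun m hm => ?_
  have h : m + Finsupp.single i 1 ∈ p.support := by
    rw [mem_support_iff, coeff_pderiv] at hm
    rw [mem_support_iff]
    exact left_ne_zero_of_mul hm
  have h' := le_totalDegree h
  change (m + Finsupp.single i 1).degree ≤ _ at h'
  rw [map_add, Finsupp.degree_single] at h'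
  rw [Finsupp.card_toMultiset]
  change m.degree ≤ _
  lia

section SegalBargmann

open MvPolynomial

variable {d : ℕ}

lemma mvLaplacian_add (p q : MvPolynomial (Fin d) ℂ) :
    mvLaplacian d (p + q) = mvLaplacian d p + mvLaplacian d q := by
  simp [mvLaplacian, Finset.sum_add_distrib]

lemma mvLaplacian_iterate_add (k : ℕ) (p q : MvPolynomial (Fin d) ℂ) :
    (mvLaplacian d)^[k] (p + q) = (mvLaplacian d)^[k] p + (mvLaplacian d)^[k] q := by
  induction k generalizing p q with
  | zero => rfl
  | succ k ih => simp only [Function.iterate_succ_apply, mvLaplacian_add, ih]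

lemma pderiv_mvLaplacian (i : Fin d) (p : MvPolynomial (Fin d) ℂ) :
    pderiv i (mvLaplacian d p) = mvLaplacian d (pderiv i p) := by
  simp only [mvLaplacian, map_sum]
  refine Finset.sum_congr rfl fun j _ => ?_
  rw [pderiv_pderiv_comm i j, pderiv_pderiv_comm i j]

lemma pderiv_mvLaplacian_iterate (k : ℕ) (i : Fin d) (p : MvPolynomial (Fin d) ℂ) :
    pderiv i ((mvLaplacian d)^[k] p) = (mvLaplacian d)^[k] (pderiv i p) := by
  induction k generalizing p with
  | zero => rfl
  | succ k ih => simp only [Function.iterate_succ_apply, ih, pderiv_mvLaplacian]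

lemma mvLaplacian_X_mul (i : Fin d) (p : MvPolynomial (Fin d) ℂ) :
    mvLaplacian d (X i * p) = X i * mvLaplacian d p + (2 : ℂ) • pderiv i p := by
  have h (j : Fin d) : pderiv j (pderiv j (X i * p)) =
      X i * pderiv j (pderiv j p) + if j = i then (2 : ℂ) • pderiv i p else 0 := by
    split_ifs with hj
    · subst hj
      simp only [two_smul, Derivation.leibniz, pderiv_X_self, smul_eq_mul, mul_one, map_add]
      ring
    · simp [pderiv_X_of_ne (Ne.symm hj)]
  simp only [mvLaplacian, h, Finset.sum_add_distrib, Finset.mul_sum, Finset.sum_ite_eq',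
    Finset.mem_univ, if_true]

lemma mvLaplacian_iterate_succ_X_mul (k : ℕ) (i : Fin d) (p : MvPolynomial (Fin d) ℂ) :
    (mvLaplacian d)^[k + 1] (X i * p) = X i * (mvLaplacian d)^[k + 1] p +
      (2 * (k + 1) : ℂ) • (mvLaplacian d)^[k] (pderiv i p) := by
  induction k generalizing p with
  | zero => simp [mvLaplacian_X_mul]
  | succ k ih =>
    have h2 (q : MvPolynomial (Fin d) ℂ) : (2 : ℂ) • q = q + q := two_smul _ _
    rw [Function.iterate_succ_apply, mvLaplacian_X_mul, mvLaplacian_iterate_add, ih,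
      h2, mvLaplacian_iterate_add, ← Function.iterate_succ_apply, pderiv_mvLaplacian,
      ← Function.iterate_succ_apply, ← h2, add_assoc, ← add_smul]
    congr 2
    push_cast
    ring

lemma mvLaplacian_iterate_eq_zero {k : ℕ} {p : MvPolynomial (Fin d) ℂ} (h : p.totalDegree < k) :
    (mvLaplacian d)^[k] p = 0 := by
  induction k generalizing p with
  | zero => simp at h
  | succ k ih =>
    rw [Function.iterate_succ_apply]
    by_cases hp : p.totalDegree = 0
    · have h0 (k : ℕ) : (mvLaplacian d)^[k] 0 = 0 :=
        Function.iterate_fixed (by simp [mvLaplacian]) k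
      rw [totalDegree_eq_zero_iff_eq_C.mp hp]
      simp [mvLaplacian, h0]
    · refine ih ((totalDegree_finsetSum _ _).trans_lt ?_)
      rw [Finset.sup_lt_iff (by simp; lia)]
      intro j _
      have h1 := totalDegree_pderiv_le j p
      have h2 := totalDegree_pderiv_le j (pderiv j p)
      lia

lemma heatOp_eq_sum_range (c : ℝ) {p : MvPolynomial (Fin d) ℂ} {N : ℕ} (h : p.totalDegree < N) :
    heatOp d c p = ∑ k ∈ Finset.range N,
      (((c : ℂ) / 2) ^ k / (Nat.factorial k : ℂ)) • (mvLaplacian d)^[k] p := by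
  refine Finset.sum_subset (Finset.range_subset_range.mpr h) fun k _ hk => ?_
  rw [mvLaplacian_iterate_eq_zero (by simpa using hk), smul_zero]

lemma heatOp_add (c : ℝ) (p q : MvPolynomial (Fin d) ℂ) :
    heatOp d c (p + q) = heatOp d c p + heatOp d c q := by
  set N := (p + q).totalDegree + p.totalDegree + q.totalDegree + 1
  rw [heatOp_eq_sum_range c (p := p + q) (N := N) (by lia),
    heatOp_eq_sum_range c (p := p) (N := N) (by lia),
    heatOp_eq_sum_range c (p := q) (N := N) (by lia), ← Finset.sum_add_distrib]
  simp [mvLaplacian_iterate_add]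

lemma heatOp_C (c : ℝ) (a : ℂ) : heatOp d c (C a) = C a := by
  simp [heatOp]

lemma pderiv_heatOp (c : ℝ) (i : Fin d) (p : MvPolynomial (Fin d) ℂ) :
    pderiv i (heatOp d c p) = heatOp d c (pderiv i p) := by
  have h := totalDegree_pderiv_le i p
  rw [heatOp_eq_sum_range c (p := pderiv i p) (N := p.totalDegree + 1) (by lia), heatOp]
  simp only [map_sum, Derivation.map_smul, pderiv_mvLaplacian_iterate]

lemma heatOp_X_mul (c : ℝ) (i : Fin d) (p : MvPolynomial (Fin d) ℂ) :
    heatOp d c (X i * p) = X i * heatOp d c p + (c : ℂ) • heatOp d c (pderiv i p) := by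
  set N := (X i * p).totalDegree + p.totalDegree + (pderiv i p).totalDegree + 1
  rw [heatOp_eq_sum_range c (p := X i * p) (N := N + 1) (by lia),
    heatOp_eq_sum_range c (p := p) (N := N + 1) (by lia),
    heatOp_eq_sum_range c (p := pderiv i p) (N := N) (by lia),
    Finset.sum_range_succ', Finset.sum_range_succ' _ N, mul_add, Finset.mul_sum, Finset.smul_sum,
    add_right_comm, ← Finset.sum_add_distrib]
  congr 1
  · refine Finset.sum_congr rfl fun k _ => ?_
    rw [mvLaplacian_iterate_succ_X_mul, smul_add, smul_smul, smul_smul, mul_smul_comm]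
    congr 2
    have : (k : ℂ) + 1 ≠ 0 := by exact_mod_cast k.succ_ne_zero
    have : (k.factorial : ℂ) ≠ 0 := by exact_mod_cast k.factorial_ne_zero
    rw [Nat.factorial_succ]
    push_cast
    field_simp
    ring
  · simp

lemma integrable_cexp_neg_sub_sq_mul_pow {t : ℝ} (ht : 0 < t) (z : ℂ) (m : ℕ) :
    Integrable fun x : ℝ => Complex.exp (-(z - x) ^ 2 / (2 * t)) * (x : ℂ) ^ m := by
  have hexp (a : ℝ) : Integrable fun x : ℝ =>
      Complex.exp (-(z - x) ^ 2 / (2 * t)) * Real.exp (a * x) := by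
    have hb : 0 < ((1 / (2 * t) : ℝ) : ℂ).re := by
      rw [Complex.ofReal_re]
      positivity
    convert! integrable_cexp_quadratic hb (z / t + a) (-z ^ 2 / (2 * t)) using 2 with x
    have : (t : ℂ) ≠ 0 := by exact_mod_cast ht.ne'
    rw [Complex.ofReal_exp, ← Complex.exp_add]
    congr 1
    push_cast
    field_simp
    ring
  refine (((hexp 1).norm.add (hexp (-1)).norm).const_mul (m.factorial : ℝ)).mono'
    (by fun_prop) (.of_forall fun x => ?_)
  have h1 : |x| ^ m ≤ m.factorial * (Real.exp (1 * x) + Real.exp (-1 * x)) := by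
    have h2 := Real.pow_div_factorial_le_exp |x| (abs_nonneg x) m
    rw [div_le_iff₀' (by positivity)] at h2
    refine h2.trans (mul_le_mul_of_nonneg_left ?_ (by positivity))
    rcases abs_cases x with ⟨h, _⟩ | ⟨h, _⟩ <;> rw [h] <;>
      simp [(Real.exp_pos _).le]
  simp only [Pi.add_apply, norm_mul, norm_pow, Complex.norm_real, Real.norm_eq_abs, Real.abs_exp]
  rw [← mul_add, mul_left_comm]
  gcongr

lemma integrable_heatKernelC_mul_evalR {t : ℝ} (ht : 0 < t) (z : Fin d → ℂ)
    (p : MvPolynomial (Fin d) ℂ) :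
    Integrable fun x : Fin d → ℝ => heatKernelC d t (z - coeRC d x) * evalR d p x := by
  induction p using MvPolynomial.induction_on' with
  | monomial m a =>
    have h := (Integrable.fintype_prod (μ := fun _ : Fin d => (volume : Measure ℝ))
      fun i => integrable_cexp_neg_sub_sq_mul_pow ht (z i) (m i)).const_mul
        ((((2 * Real.pi * t) ^ (-(d : ℝ) / 2) : ℝ) : ℂ) * a)
    refine h.congr (.of_forall fun x => ?_)
    simp only [heatKernelC, evalR, coeRC, eval_monomial, Pi.sub_apply, Finset.prod_mul_distrib,
      ← Complex.exp_sum, ← Finset.sum_div, Finset.sum_neg_distrib]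
    rw [Finsupp.prod_fintype _ _ (by simp)]
    ring
  | add p q hp hq =>
    refine (hp.add hq).congr (.of_forall fun x => ?_)
    simp [evalR, mul_add]

lemma integral_heatKernelC {t : ℝ} (ht : 0 < t) (z : Fin d → ℂ) :
    ∫ x : Fin d → ℝ, heatKernelC d t (z - coeRC d x) = 1 := by
  have hb : 0 < ((1 / (2 * t) : ℝ) : ℂ).re := by
    rw [Complex.ofReal_re]
    positivity
  have htC : (t : ℂ) ≠ 0 := by exact_mod_cast ht.ne'
  have h (x : Fin d → ℝ) : heatKernelC d t (z - coeRC d x) =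
      ((((2 * Real.pi * t) ^ (-(d : ℝ) / 2) : ℝ) : ℂ) * Complex.exp (-(∑ i, z i ^ 2) / (2 * t))) *
        Complex.exp (-((1 / (2 * t) : ℝ) : ℂ) * ∑ i, (x i : ℂ) ^ 2 + ∑ i, z i / t * x i) := by
    rw [heatKernelC, mul_assoc (Complex.ofReal _), ← Complex.exp_add]
    congr 2
    simp only [coeRC, Pi.sub_apply, neg_div, Finset.sum_div, Finset.mul_sum,
      ← Finset.sum_neg_distrib, ← Finset.sum_add_distrib]
    refine Finset.sum_congr rfl fun i _ => ?_
    push_cast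
    field_simp
    ring
  simp_rw [h]
  rw [integral_const_mul, GaussianFourier.integral_cexp_neg_mul_sum_add hb]
  have hpow : ((Real.pi : ℂ) / ((1 / (2 * t) : ℝ) : ℂ)) ^ ((Fintype.card (Fin d) : ℂ) / 2) =
      (((2 * Real.pi * t) ^ ((d : ℝ) / 2) : ℝ) : ℂ) := by
    rw [Complex.ofReal_cpow (by positivity), Fintype.card_fin]
    push_cast
    congr 1
    field_simp
  have hexp : Complex.exp (-(∑ i, z i ^ 2) / (2 * t)) *
      Complex.exp ((∑ i, (z i / t) ^ 2) / (4 * ((1 / (2 * t) : ℝ) : ℂ))) = 1 := by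
    rw [← Complex.exp_add, Complex.exp_eq_one_iff]
    refine ⟨0, ?_⟩
    simp only [div_pow, ← Finset.sum_div]
    push_cast
    field_simp
    ring
  rw [hpow, mul_mul_mul_comm, hexp, ← Complex.ofReal_mul, ← Real.rpow_add (by positivity)]
  simp [neg_div]

lemma hasDerivAt_add_smul_single_apply (x : Fin d → ℝ) (i j : Fin d) :
    HasDerivAt (fun τ : ℝ => (((x + τ • (Pi.single i 1 : Fin d → ℝ)) j : ℝ) : ℂ))
      (if j = i then 1 else 0) 0 := by
  have h : HasDerivAt (fun τ : ℝ => x j + τ * (Pi.single i (1 : ℝ) : Fin d → ℝ) j)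
      ((Pi.single i (1 : ℝ) : Fin d → ℝ) j) 0 := by
    simpa using ((hasDerivAt_id (0 : ℝ)).mul_const _).const_add (x j)
  convert! h.ofReal_comp using 1
  split_ifs with hj <;> simp [hj]

lemma hasLineDerivAt_evalR (p : MvPolynomial (Fin d) ℂ) (x : Fin d → ℝ) (i : Fin d) :
    HasLineDerivAt ℝ (evalR d p) (evalR d (pderiv i p) x) x (Pi.single i 1) := by
  unfold HasLineDerivAt evalR
  induction p using MvPolynomial.induction_on with
  | C a => simpa using hasDerivAt_const (0 : ℝ) a
  | add p q hp hq => simpa using hp.fun_add hq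
  | mul_X p j hp =>
    convert! hp.mul (hasDerivAt_add_smul_single_apply x i j) using 1
    · ext τ
      simp
    · by_cases h : j = i
      · subst h
        simp
        ring
      · simp [pderiv_X_of_ne h, h]
        ring

lemma hasLineDerivAt_heatKernelC {t : ℝ} (ht : 0 < t) (z : Fin d → ℂ) (x : Fin d → ℝ)
    (i : Fin d) :
    HasLineDerivAt ℝ (fun x => heatKernelC d t (z - coeRC d x))
      (heatKernelC d t (z - coeRC d x) * ((z i - x i) / t)) x (Pi.single i 1) := by
  unfold HasLineDerivAt heatKernelC coeRC
  have htC : (t : ℂ) ≠ 0 := by exact_mod_cast ht.ne'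
  have h := ((((HasDerivAt.fun_sum (u := Finset.univ) fun j _ =>
    ((hasDerivAt_add_smul_single_apply x i j).const_sub (z j)).fun_pow 2).neg).div_const
      (2 * t : ℂ)).cexp).const_mul (((2 * Real.pi * t) ^ (-(d : ℝ) / 2) : ℝ) : ℂ)
  convert! h using 1
  simp only [Pi.neg_apply, zero_smul, add_zero, mul_neg, mul_ite, mul_one, mul_zero,
    Finset.sum_neg_distrib, Finset.sum_ite_eq', Finset.mem_univ, if_true, neg_neg,
    Pi.sub_apply, mul_assoc]
  field_simp
  simp

lemma integral_heatKernelC_mul_evalR_X_mul {t : ℝ} (ht : 0 < t) (z : Fin d → ℂ) (i : Fin d)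
    (p : MvPolynomial (Fin d) ℂ) :
    ∫ x : Fin d → ℝ, heatKernelC d t (z - coeRC d x) * evalR d (X i * p) x =
      z i * (∫ x : Fin d → ℝ, heatKernelC d t (z - coeRC d x) * evalR d p x) +
        t * ∫ x : Fin d → ℝ, heatKernelC d t (z - coeRC d x) * evalR d (pderiv i p) x := by
  have htC : (t : ℂ) ≠ 0 := by exact_mod_cast ht.ne'
  have hI := integrable_heatKernelC_mul_evalR ht z
  have hx (x : Fin d → ℝ) :
      heatKernelC d t (z - coeRC d x) * ((z i - x i) / t) * evalR d p x =
        z i / t * (heatKernelC d t (z - coeRC d x) * evalR d p x) -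
          (1 / t : ℂ) * (heatKernelC d t (z - coeRC d x) * evalR d (X i * p) x) := by
    simp only [evalR, eval_mul, eval_X]
    ring
  have h := integral_bilinear_hasLineDerivAt_right_eq_neg_left_of_integrable
    (μ := (volume : Measure (Fin d → ℝ))) (B := ContinuousLinearMap.mul ℝ ℂ)
    (f := fun x => heatKernelC d t (z - coeRC d x)) (g := evalR d p) (v := Pi.single i 1)
    (f' := fun x => heatKernelC d t (z - coeRC d x) * ((z i - x i) / t))
    (g' := evalR d (pderiv i p))
    (by
      simp only [ContinuousLinearMap.mul_apply', hx]
      exact ((hI p).const_mul _).sub ((hI _).const_mul _))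
    (hI _) (hI _) (fun x _ => hasLineDerivAt_heatKernelC ht z x i)
    (fun x _ => hasLineDerivAt_evalR p x i)
  simp only [ContinuousLinearMap.mul_apply', hx] at h
  rw [integral_sub ((hI p).const_mul _) ((hI _).const_mul _), integral_const_mul,
    integral_const_mul] at h
  rw [h]
  field_simp
  ring

lemma integral_heatKernelC_mul_evalR_add {t : ℝ} (ht : 0 < t) (z : Fin d → ℂ)
    (p q : MvPolynomial (Fin d) ℂ) :
    ∫ x : Fin d → ℝ, heatKernelC d t (z - coeRC d x) * evalR d (p + q) x =
      (∫ x : Fin d → ℝ, heatKernelC d t (z - coeRC d x) * evalR d p x) +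
        ∫ x : Fin d → ℝ, heatKernelC d t (z - coeRC d x) * evalR d q x := by
  rw [← integral_add (integrable_heatKernelC_mul_evalR ht z p)
    (integrable_heatKernelC_mul_evalR ht z q)]
  simp [evalR, mul_add]

lemma integral_heatKernelC_mul_evalR_smul (t : ℝ) (z : Fin d → ℂ) (a : ℂ)
    (p : MvPolynomial (Fin d) ℂ) :
    ∫ x : Fin d → ℝ, heatKernelC d t (z - coeRC d x) * evalR d (a • p) x =
      a * ∫ x : Fin d → ℝ, heatKernelC d t (z - coeRC d x) * evalR d p x := by
  rw [← integral_const_mul]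
  simp [evalR, mul_left_comm]

/-- Convolving `e^{cΔ/2}p` with the Gaussian of variance `t` gives `e^{(c+t)Δ/2}p`. -/
lemma integral_heatKernelC_mul_evalR_heatOp {t : ℝ} (ht : 0 < t) (c : ℝ) (z : Fin d → ℂ)
    (p : MvPolynomial (Fin d) ℂ) :
    ∫ x : Fin d → ℝ, heatKernelC d t (z - coeRC d x) * evalR d (heatOp d c p) x =
      eval z (heatOp d (t + c) p) := by
  induction p using MvPolynomial.induction_on' with
  | add p q hp hq =>
    rw [heatOp_add, integral_heatKernelC_mul_evalR_add ht, hp, hq, heatOp_add, eval_add]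
  | monomial m a =>
    induction hn : m.degree using Nat.strong_induction_on generalizing m a with
    | _ n ih =>
    rcases eq_or_ne m 0 with rfl | hm
    · rw [show monomial (0 : Fin d →₀ ℕ) a = C a from rfl, heatOp_C, heatOp_C, eval_C]
      simp [evalR, integral_mul_const, integral_heatKernelC ht]
    · obtain ⟨i, hi⟩ := Finsupp.ne_iff.mp hm
      obtain ⟨l, rfl⟩ : ∃ l, m = Finsupp.single i 1 + l :=
        exists_add_of_le (Finsupp.single_le_iff.mpr (Nat.one_le_iff_ne_zero.mpr hi))
      rw [map_add, Finsupp.degree_single] at hn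
      have hX : monomial (Finsupp.single i 1 + l) a = X i * monomial l a := by
        rw [X, monomial_mul, one_mul]
      have hl := ih l.degree (by lia) l a rfl
      have hl' := ih (l - Finsupp.single i 1).degree
        ((Finsupp.degree_mono tsub_le_self).trans_lt (by lia)) _ (a * l i) rfl
      rw [← pderiv_monomial] at hl'
      rw [hX, heatOp_X_mul, integral_heatKernelC_mul_evalR_add ht,
        integral_heatKernelC_mul_evalR_X_mul ht, integral_heatKernelC_mul_evalR_smul, hl,
        pderiv_heatOp, hl',
        heatOp_X_mul, eval_add, eval_mul, eval_X, smul_eval]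
      push_cast
      ring

end SegalBargmann

/-- Theorem 3.8. For `s > t/2 > 0` and `p` homogeneous of degree `n`,
with `q = e^{(t-s)Δ/2}p`, the Segal-Bargmann transform of `e^{-sΔ/2}p` is the evaluation
of `q` at complex points: `S_{s,t}(e^{-sΔ/2}p) = e^{-A_{s,t}/2}(p_ℂ) = q_ℂ`. -/
theorem segalBargmann_on_hermite
    (d : ℕ) (hd : 1 ≤ d) (s t : ℝ) (ht : 0 < t / 2) (hst : t / 2 < s)
    (p : MvPolynomial (Fin d) ℂ) (n : ℕ) (hp : p.IsHomogeneous n) :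
    ∀ z : Fin d → ℂ,
      ∫ x : Fin d → ℝ, heatKernelC d t (z - coeRC d x) * evalR d (heatOp d (-s) p) x
        = MvPolynomial.eval z (heatOp d (t - s) p) := by
  intro z
  rw [integral_heatKernelC_mul_evalR_heatOp (by linarith), ← sub_eq_add_neg]
end
end

section
/- Fix an integer d ≥ 1 and real numbers s, t with s > t/2 > 0. The holomorphic polynomial functions are dense in the holomorphic subspace of L²(ℂ^d, M_{s,t}): for every holomorphic function F : ℂ^d → ℂ with ∫_{ℂ^d} |F|² dM_{s,t} < ∞ and every ε > 0, there exists a polynomial function q : ℂ^d → ℂ (a polynomial in z_1, …, z_d with complex coefficients) such that ∫_{ℂ^d} |F(z) − q(z)|² dM_{s,t}(z) < ε. -/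
open MeasureTheory ENNReal

noncomputable section

/-- The density of the Gaussian measure `M_{s,t}` on `ℂ^d`:
`M_{s,t}(z) = (πr)^{-d/2} (πt)^{-d/2} exp(-|x|²/r - |y|²/t)` with `r = 2(s - t/2)`,
where `z = x + iy`. -/
def MDensity (d : ℕ) (s t : ℝ) (z : Fin d → ℂ) : ℝ :=
  (Real.pi * (2 * (s - t / 2))) ^ (-(d : ℝ) / 2) * (Real.pi * t) ^ (-(d : ℝ) / 2) *
    Real.exp (-(∑ i, (z i).re ^ 2) / (2 * (s - t / 2)) - (∑ i, (z i).im ^ 2) / t)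

/-- The Gaussian measure `M_{s,t}` on `ℂ^d`. -/
def MMeasure (d : ℕ) (s t : ℝ) : Measure (Fin d → ℂ) :=
  volume.withDensity fun z => ENNReal.ofReal (MDensity d s t z)

/-- The squared Hermitian norm on `ℂ^d`. -/
def normSqSum {d : ℕ} (z : Fin d → ℂ) : ℝ := ∑ i, ‖z i‖ ^ 2

@[fun_prop]
theorem continuous_normSqSum {d : ℕ} : Continuous (normSqSum (d := d)) := by
  unfold normSqSum; fun_prop

theorem integrable_exp_neg_mul_normSqSum {d : ℕ} {c : ℝ} (hc : 0 < c) :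
    Integrable (fun z : Fin d → ℂ => Real.exp (-c * normSqSum z)) := by
  have h1 : Integrable (fun v : ℂ => Real.exp (-c * ‖v‖ ^ 2)) := by
    have h := (GaussianFourier.integrable_cexp_neg_mul_sq_norm_add (V := ℂ) (b := (c : ℂ))
      (by simpa using hc) 0 0).norm
    refine h.congr (ae_of_all _ fun v => ?_)
    simp [Complex.norm_exp, ← Complex.ofReal_pow]
  have h2 := Integrable.fintype_prod (ι := Fin d) (f := fun _ (v : ℂ) => Real.exp (-c * ‖v‖ ^ 2))
    (fun _ => h1)
  refine h2.congr (ae_of_all _ fun z => ?_)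
  simp [normSqSum, ← Real.exp_sum, Finset.mul_sum]

theorem measurePreserving_circle_smul {d : ℕ} (θ : ℝ) :
    MeasurePreserving (fun z : Fin d → ℂ => Complex.exp (θ * Complex.I) • z) := by
  have h := volume_preserving_pi (ι := Fin d)
    (f := fun _ => (rotation (Circle.exp θ) : ℂ → ℂ))
    (fun _ => (rotation (Circle.exp θ)).measurePreserving)
  convert h using 1
  ext z i
  simp [rotation_apply]

theorem normSqSum_circle_smul {d : ℕ} (θ : ℝ) (z : Fin d → ℂ) :
    normSqSum (Complex.exp (θ * Complex.I) • z) = normSqSum z := by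
  simp [normSqSum, Complex.norm_exp_ofReal_mul_I]

theorem integral_circle_smul_of_differentiable {d : ℕ} {J : (Fin d → ℂ) → ℂ}
    (hJ : Differentiable ℂ J) (z : Fin d → ℂ) :
    ∫ θ in (0 : ℝ)..2 * Real.pi, J (Complex.exp (θ * Complex.I) • z) = 2 * Real.pi * J 0 := by
  have hd : Differentiable ℂ (fun u : ℂ => J (u • z)) := by fun_prop
  have h := DiffContOnCl.circleAverage (R := 1) (c := 0) hd.diffContOnCl
  rw [Real.circleAverage_def] at h
  simp only [circleMap, zero_smul, zero_add, Complex.ofReal_one, one_mul] at h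
  rw [← h, Complex.real_smul]
  push_cast
  rw [← mul_assoc, mul_inv_cancel₀ (by simp), one_mul]

/-- The mean value property of holomorphic functions against an isotropic Gaussian weight. -/
theorem integral_holomorphic_mul_gaussian {d : ℕ} {c : ℝ} {J : (Fin d → ℂ) → ℂ}
    (hJ : Differentiable ℂ J)
    (hint : Integrable (fun z => J z * (Real.exp (-c * normSqSum z) : ℂ))) :
    ∫ z, J z * (Real.exp (-c * normSqSum z) : ℂ)
      = J 0 * ∫ z : Fin d → ℂ, (Real.exp (-c * normSqSum z) : ℂ) := by
  set K : (Fin d → ℂ) → ℂ := fun z => J z * (Real.exp (-c * normSqSum z) : ℂ) with hK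
  have hKc : Continuous K := by
    have := hJ.continuous
    fun_prop
  have hmp := fun θ => measurePreserving_circle_smul (d := d) θ
  have hemb : ∀ θ : ℝ,
      MeasurableEmbedding (fun z : Fin d → ℂ => Complex.exp (θ * Complex.I) • z) := fun θ =>
    (MeasurableEquiv.smul₀ (α := Fin d → ℂ) (Complex.exp (θ * Complex.I))
      (Complex.exp_ne_zero _)).measurableEmbedding
  have hrot : ∀ θ : ℝ, ∫ z, K (Complex.exp (θ * Complex.I) • z) = ∫ z, K z := fun θ =>
    (hmp θ).integral_comp (hemb θ) K
  have hprod : Integrable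
      (Function.uncurry fun (θ : ℝ) (z : Fin d → ℂ) => K (Complex.exp (θ * Complex.I) • z))
      ((volume.restrict (Set.uIoc 0 (2 * Real.pi))).prod volume) := by
    rw [integrable_prod_iff]
    · refine ⟨ae_of_all _ fun θ => (hmp θ).integrable_comp_of_integrable hint, ?_⟩
      have : ∀ θ : ℝ, ∫ z, ‖K (Complex.exp (θ * Complex.I) • z)‖ = ∫ z, ‖K z‖ := fun θ =>
        (hmp θ).integral_comp (hemb θ) (fun z => ‖K z‖)
      simp only [Function.uncurry_apply_pair, this]
      have : IsFiniteMeasure (volume.restrict (Set.uIoc 0 (2 * Real.pi))) :=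
        ⟨by simp [Set.uIoc]⟩
      exact integrable_const _
    · refine Continuous.aestronglyMeasurable ?_
      unfold Function.uncurry
      fun_prop
  have hswap := intervalIntegral_integral_swap hprod
  simp only [hrot, intervalIntegral.integral_const, sub_zero] at hswap
  have hin : ∀ z : Fin d → ℂ, ∫ θ in (0 : ℝ)..2 * Real.pi, K (Complex.exp (θ * Complex.I) • z)
      = 2 * Real.pi * J 0 * (Real.exp (-c * normSqSum z) : ℂ) := by
    intro z
    simp only [hK, normSqSum_circle_smul]
    rw [intervalIntegral.integral_mul_const, integral_circle_smul_of_differentiable hJ]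
  simp only [hin] at hswap
  rw [integral_const_mul, Complex.real_smul] at hswap
  have hpi : (2 * Real.pi : ℂ) ≠ 0 := by simp
  apply mul_left_cancel₀ hpi
  push_cast at hswap ⊢
  rw [hswap]; ring

/-- The quadratic form `a |x|² + b |y|²` at `z = x + iy`. -/
def anisoQuad {d : ℕ} (a b : ℝ) (z : Fin d → ℂ) : ℝ :=
  a * ∑ i, (z i).re ^ 2 + b * ∑ i, (z i).im ^ 2

@[fun_prop]
theorem continuous_anisoQuad {d : ℕ} (a b : ℝ) : Continuous (anisoQuad (d := d) a b) := by
  unfold anisoQuad; fun_prop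

/-- The measure with density `A exp (-(a |x|² + b |y|²))`. -/
def anisoGaussian (d : ℕ) (A a b : ℝ) : Measure (Fin d → ℂ) :=
  volume.withDensity fun z => ENNReal.ofReal (A * Real.exp (-anisoQuad a b z))

/-- The holomorphic quadratic form `∑ zᵢ²`. -/
def sumSq {d : ℕ} (z : Fin d → ℂ) : ℂ := ∑ i, z i ^ 2

theorem sumSq_re {d : ℕ} (z : Fin d → ℂ) :
    (sumSq z).re = ∑ i, (z i).re ^ 2 - ∑ i, (z i).im ^ 2 := by
  simp [sumSq, sq, Finset.sum_sub_distrib]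

theorem normSqSum_eq {d : ℕ} (z : Fin d → ℂ) :
    normSqSum z = ∑ i, (z i).re ^ 2 + ∑ i, (z i).im ^ 2 := by
  simp only [normSqSum, Complex.sq_norm, Complex.normSq_apply, ← Finset.sum_add_distrib, ← sq]

theorem norm_sumSq_le {d : ℕ} (z : Fin d → ℂ) : ‖sumSq z‖ ≤ normSqSum z := by
  refine (norm_sum_le _ _).trans_eq ?_
  simp [normSqSum]

theorem anisoQuad_eq {d : ℕ} (a b : ℝ) (z : Fin d → ℂ) :
    anisoQuad a b z = (a + b) / 2 * normSqSum z + (a - b) / 2 * (sumSq z).re := by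
  rw [normSqSum_eq, sumSq_re, anisoQuad]; ring

/-- `h` is bounded by a function that is square integrable against `exp (-anisoQuad a b)`
with room for factors of exponential type. -/
def Subordinate {d : ℕ} (a b : ℝ) (h : (Fin d → ℂ) → ℂ) : Prop :=
  ∃ C η : ℝ, 0 < η ∧ ∀ z, ‖h z‖ ≤ C * Real.exp (anisoQuad a b z / 2 - η * normSqSum z)

theorem integrable_anisoGaussian_iff {d : ℕ} {A a b : ℝ} (hA : 0 < A) {E : Type*}
    [NormedAddCommGroup E] [NormedSpace ℝ E] {g : (Fin d → ℂ) → E} :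
    Integrable g (anisoGaussian d A a b) ↔
      Integrable (fun z => (A * Real.exp (-anisoQuad a b z)) • g z) := by
  rw [anisoGaussian, integrable_withDensity_iff_integrable_smul' (by fun_prop) (by simp)]
  refine integrable_congr (ae_of_all _ fun z => ?_)
  simp only
  rw [ENNReal.toReal_ofReal (by positivity)]

theorem integral_anisoGaussian {d : ℕ} {A a b : ℝ} (hA : 0 < A) {E : Type*}
    [NormedAddCommGroup E] [NormedSpace ℝ E] (g : (Fin d → ℂ) → E) :
    ∫ z, g z ∂(anisoGaussian d A a b) = ∫ z, (A * Real.exp (-anisoQuad a b z)) • g z := by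
  rw [anisoGaussian, integral_withDensity_eq_integral_toReal_smul (by fun_prop) (by simp)]
  refine integral_congr_ae (ae_of_all _ fun z => ?_)
  simp only
  rw [ENNReal.toReal_ofReal (by positivity)]

theorem Subordinate.memLp {d : ℕ} {A a b : ℝ} (hA : 0 < A) {h : (Fin d → ℂ) → ℂ}
    (hh : Subordinate a b h) (hc : Continuous h) : MemLp h 2 (anisoGaussian d A a b) := by
  obtain ⟨C, η, hη, hb⟩ := hh
  rw [memLp_two_iff_integrable_sq_norm hc.aestronglyMeasurable, integrable_anisoGaussian_iff hA]
  refine ((integrable_exp_neg_mul_normSqSum (d := d) (c := 2 * η) (by positivity)).const_mul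
    (A * C ^ 2)).mono' (by fun_prop) (ae_of_all _ fun z => ?_)
  have h1 : ‖h z‖ ^ 2 ≤ (C * Real.exp (anisoQuad a b z / 2 - η * normSqSum z)) ^ 2 := by
    gcongr; exact hb z
  rw [smul_eq_mul, Real.norm_of_nonneg (by positivity)]
  calc A * Real.exp (-anisoQuad a b z) * ‖h z‖ ^ 2
      ≤ A * Real.exp (-anisoQuad a b z) *
        (C * Real.exp (anisoQuad a b z / 2 - η * normSqSum z)) ^ 2 := by gcongr
    _ = A * C ^ 2 * (Real.exp (-anisoQuad a b z) *
        Real.exp (anisoQuad a b z / 2 - η * normSqSum z) ^ 2) := by ring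
    _ = _ := by
      rw [← Real.exp_nat_mul, ← Real.exp_add]
      congr 2; push_cast; ring

theorem Subordinate.add {d : ℕ} {a b : ℝ} {h k : (Fin d → ℂ) → ℂ}
    (hh : Subordinate a b h) (hk : Subordinate a b k) :
    Subordinate a b (fun z => h z + k z) := by
  obtain ⟨C, η, hη, hC⟩ := hh
  obtain ⟨D, θ, hθ, hD⟩ := hk
  have hC0 : 0 ≤ C := by
    have := (norm_nonneg _).trans (hC 0)
    exact nonneg_of_mul_nonneg_left this (Real.exp_pos _)
  have hD0 : 0 ≤ D := by
    have := (norm_nonneg _).trans (hD 0)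
    exact nonneg_of_mul_nonneg_left this (Real.exp_pos _)
  refine ⟨C + D, min η θ, lt_min hη hθ, fun z => ?_⟩
  have hs : 0 ≤ normSqSum z := Finset.sum_nonneg fun i _ => by positivity
  calc ‖h z + k z‖ ≤ C * Real.exp (anisoQuad a b z / 2 - η * normSqSum z) +
        D * Real.exp (anisoQuad a b z / 2 - θ * normSqSum z) :=
        (norm_add_le _ _).trans (add_le_add (hC z) (hD z))
    _ ≤ C * Real.exp (anisoQuad a b z / 2 - min η θ * normSqSum z) +
        D * Real.exp (anisoQuad a b z / 2 - min η θ * normSqSum z) := by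
        gcongr
        · exact min_le_left _ _
        · exact min_le_right _ _
    _ = _ := by ring

theorem Subordinate.mul_expType {d : ℕ} {a b : ℝ} {h k : (Fin d → ℂ) → ℂ}
    (hh : Subordinate a b h) {B : ℝ} {R : Fin d → ℝ}
    (hk : ∀ z, ‖k z‖ ≤ B * Real.exp (∑ i, R i * ‖z i‖)) :
    Subordinate a b (fun z => k z * h z) := by
  obtain ⟨C, η, hη, hC⟩ := hh
  have hC0 : 0 ≤ C := by
    have := (norm_nonneg _).trans (hC 0)
    exact nonneg_of_mul_nonneg_left this (Real.exp_pos _)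
  have hB0 : 0 ≤ B := by
    have := (norm_nonneg _).trans (hk 0)
    exact nonneg_of_mul_nonneg_left this (Real.exp_pos _)
  refine ⟨B * C * Real.exp (∑ i, R i ^ 2 / (2 * η)), η / 2, by positivity, fun z => ?_⟩
  rw [norm_mul]
  have key : ∑ i, R i * ‖z i‖ ≤ ∑ i, R i ^ 2 / (2 * η) + η / 2 * normSqSum z := by
    rw [normSqSum, Finset.mul_sum, ← Finset.sum_add_distrib]
    refine Finset.sum_le_sum fun i _ => ?_
    have : R i ^ 2 / (2 * η) + η / 2 * ‖z i‖ ^ 2 - R i * ‖z i‖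
        = (R i - η * ‖z i‖) ^ 2 / (2 * η) := by field_simp; ring
    have h2 : 0 ≤ (R i - η * ‖z i‖) ^ 2 / (2 * η) := by positivity
    linarith
  calc ‖k z‖ * ‖h z‖ ≤ (B * Real.exp (∑ i, R i * ‖z i‖)) *
        (C * Real.exp (anisoQuad a b z / 2 - η * normSqSum z)) := by
        gcongr
        · exact hk z
        · exact hC z
    _ = B * C * Real.exp (∑ i, R i * ‖z i‖ + (anisoQuad a b z / 2 - η * normSqSum z)) := by
        rw [Real.exp_add]; ring
    _ ≤ B * C * Real.exp (∑ i, R i ^ 2 / (2 * η) +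
          (anisoQuad a b z / 2 - η / 2 * normSqSum z)) := by
        gcongr ?_ * Real.exp ?_
        linarith
    _ = _ := by rw [Real.exp_add]; ring

theorem Subordinate.mul_coord {d : ℕ} {a b : ℝ} {h : (Fin d → ℂ) → ℂ}
    (hh : Subordinate a b h) (i : Fin d) : Subordinate a b (fun z => z i * h z) := by
  refine hh.mul_expType (B := 1) (R := fun _ => 1) fun z => ?_
  have h1 : ‖z i‖ ≤ ∑ j, 1 * ‖z j‖ := by
    simp only [one_mul]
    exact Finset.single_le_sum (f := fun j => ‖z j‖) (fun j _ => norm_nonneg _) (Finset.mem_univ i)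
  have h2 := Real.add_one_le_exp (∑ j, 1 * ‖z j‖)
  linarith

theorem Subordinate.const_mul {d : ℕ} {a b : ℝ} {h : (Fin d → ℂ) → ℂ}
    (hh : Subordinate a b h) (w : ℂ) : Subordinate a b (fun z => w * h z) :=
  hh.mul_expType (B := ‖w‖) (R := fun _ => 0) fun z => by simp

theorem Subordinate.mul_polynomial {d : ℕ} {a b : ℝ} {h : (Fin d → ℂ) → ℂ}
    (hh : Subordinate a b h) (p : MvPolynomial (Fin d) ℂ) :
    Subordinate a b (fun z => MvPolynomial.eval z p * h z) := by
  induction p using MvPolynomial.induction_on with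
  | C w => simpa using hh.const_mul w
  | add p q hp hq => simpa [add_mul] using hp.add hq
  | mul_X p i hp =>
    convert hp.mul_coord i using 2 with z
    simp; ring

theorem Subordinate.one {d : ℕ} {a b : ℝ} (ha : 0 < a) (hb : 0 < b) :
    Subordinate (d := d) a b (fun _ => 1) := by
  refine ⟨1, min a b / 2, by positivity, fun z => ?_⟩
  rw [norm_one, one_mul, Real.one_le_exp_iff, normSqSum_eq, anisoQuad]
  have h1 : 0 ≤ ∑ i, (z i).re ^ 2 := Finset.sum_nonneg fun i _ => by positivity
  have h2 : 0 ≤ ∑ i, (z i).im ^ 2 := Finset.sum_nonneg fun i _ => by positivity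
  have h3 := mul_le_mul_of_nonneg_right (min_le_left a b) h1
  have h4 := mul_le_mul_of_nonneg_right (min_le_right a b) h2
  linarith

/-- The polynomial functions, as a subspace of `L²(μ)`. -/
def polynomialLp {d : ℕ} (μ : Measure (Fin d → ℂ)) : Submodule ℂ (Lp ℂ 2 μ) where
  carrier := {g | ∃ q : MvPolynomial (Fin d) ℂ, g =ᵐ[μ] fun z => MvPolynomial.eval z q}
  zero_mem' := ⟨0, by simpa using! Lp.coeFn_zero ℂ 2 μ⟩
  add_mem' := by
    rintro g h ⟨p, hp⟩ ⟨q, hq⟩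
    refine ⟨p + q, ?_⟩
    filter_upwards [Lp.coeFn_add g h, hp, hq] with z h1 h2 h3
    rw [h1]
    simp [h2, h3]
  smul_mem' := by
    rintro w g ⟨p, hp⟩
    refine ⟨MvPolynomial.C w * p, ?_⟩
    filter_upwards [Lp.coeFn_smul w g, hp] with z h1 h2
    simp [h1, h2]

theorem tendsto_toLp_of_dominated {α : Type*} [MeasurableSpace α] {μ : Measure α}
    {f : ℕ → α → ℂ} {g : α → ℂ} {B : α → ℂ} (hf : ∀ n, MemLp (f n) 2 μ) (hg : MemLp g 2 μ)
    (hB : MemLp B 2 μ) (hbd : ∀ n z, ‖f n z - g z‖ ≤ ‖B z‖)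
    (hlim : ∀ z, Filter.Tendsto (fun n => f n z) Filter.atTop (nhds (g z))) :
    Filter.Tendsto (fun n => (hf n).toLp (f n)) Filter.atTop (nhds (hg.toLp g)) := by
  rw [Lp.tendsto_Lp_iff_tendsto_eLpNorm'']
  simp only [eLpNorm_eq_lintegral_rpow_enorm_toReal two_ne_zero ENNReal.ofNat_ne_top,
    ENNReal.toReal_ofNat, Pi.sub_apply]
  have hBfin := eLpNorm_lt_top_iff_lintegral_rpow_enorm_lt_top two_ne_zero
    ENNReal.ofNat_ne_top |>.1 hB.2
  have h := tendsto_lintegral_of_dominated_convergence' (μ := μ)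
    (F := fun n z => ‖f n z - g z‖ₑ ^ (2 : ℝ)) (f := fun _ => 0)
    (fun z => ‖B z‖ₑ ^ (2 : ℝ)) (fun n => (((hf n).1.sub hg.1).enorm.pow_const _))
    (fun n => ae_of_all _ fun z => by
      have : ‖f n z - g z‖ₑ ≤ ‖B z‖ₑ := enorm_le_iff_norm_le.2 (hbd n z)
      exact ENNReal.rpow_le_rpow this zero_le_two)
    (by simpa using hBfin.ne)
    (ae_of_all _ fun z => by
      have h1 : Filter.Tendsto (fun n => ‖f n z - g z‖ₑ) Filter.atTop (nhds 0) := by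
        have := ((hlim z).sub_const (g z)).enorm
        simpa using this
      have := h1.ennrpow_const (2 : ℝ)
      simpa using this)
  have := h.ennrpow_const (1 / 2 : ℝ)
  simpa using this

/-- If all polynomial multiples of `g` are limits of polynomials and `exp ‖Q‖ * g` is still
subordinate to the weight, then all polynomial multiples of `exp Q * g` are limits of
polynomials. -/
theorem mem_closure_exp_mul {d : ℕ} {A a b : ℝ} (hA : 0 < A) {g : (Fin d → ℂ) → ℂ}
    (hgc : Continuous g) (Q : MvPolynomial (Fin d) ℂ)
    (hdom : Subordinate a b fun z => (Real.exp ‖MvPolynomial.eval z Q‖ : ℂ) * g z)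
    (hg : ∀ (p : MvPolynomial (Fin d) ℂ)
      (hm : MemLp (fun z => MvPolynomial.eval z p * g z) 2 (anisoGaussian d A a b)),
      hm.toLp _ ∈ (polynomialLp (anisoGaussian d A a b)).topologicalClosure)
    (p : MvPolynomial (Fin d) ℂ)
    (hm : MemLp (fun z => MvPolynomial.eval z p * (Complex.exp (MvPolynomial.eval z Q) * g z)) 2
      (anisoGaussian d A a b)) :
    hm.toLp _ ∈ (polynomialLp (anisoGaussian d A a b)).topologicalClosure := by
  have hev : ∀ q : MvPolynomial (Fin d) ℂ, Continuous fun z => MvPolynomial.eval z q :=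
    fun q => MvPolynomial.continuous_eval q
  have hQc := hev Q
  set B : (Fin d → ℂ) → ℂ :=
    fun z => MvPolynomial.eval z p * ((Real.exp ‖MvPolynomial.eval z Q‖ : ℂ) * g z) with hBdef
  have hpc := hev p
  have hB : MemLp B 2 (anisoGaussian d A a b) :=
    (hdom.mul_polynomial p).memLp hA (by fun_prop)
  set P : ℕ → MvPolynomial (Fin d) ℂ := fun n =>
    p * ∑ k ∈ Finset.range n, MvPolynomial.C ((k.factorial : ℂ)⁻¹) * Q ^ k with hP
  have hPev : ∀ n z, MvPolynomial.eval z (P n) * g z = MvPolynomial.eval z p *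
      ((∑ k ∈ Finset.range n, MvPolynomial.eval z Q ^ k / (k.factorial : ℂ)) * g z) := by
    intro n z
    simp [hP, div_eq_inv_mul, mul_assoc]
  have hsum : ∀ n z, ‖∑ k ∈ Finset.range n, MvPolynomial.eval z Q ^ k / (k.factorial : ℂ)‖
      ≤ Real.exp ‖MvPolynomial.eval z Q‖ := by
    intro n z
    refine (norm_sum_le _ _).trans ?_
    refine le_trans (le_of_eq ?_) (Real.sum_le_exp_of_nonneg (norm_nonneg _) n)
    simp
  have hBn : ∀ z, ‖B z‖ = ‖MvPolynomial.eval z p‖ *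
      (Real.exp ‖MvPolynomial.eval z Q‖ * ‖g z‖) := by
    intro z
    simp [hBdef, Complex.norm_exp]
  have hfb : ∀ n z, ‖MvPolynomial.eval z (P n) * g z‖ ≤ ‖B z‖ := by
    intro n z
    rw [hPev, norm_mul, norm_mul, hBn]
    gcongr
    exact hsum n z
  have hf : ∀ n, MemLp (fun z => MvPolynomial.eval z (P n) * g z) 2 (anisoGaussian d A a b) :=
    fun n => hB.mono (((hev (P n)).mul hgc).aestronglyMeasurable) (ae_of_all _ (hfb n))
  have hlim := tendsto_toLp_of_dominated hf hm (hB.const_mul 2) (fun n z => ?_) (fun z => ?_)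
  · exact (Submodule.isClosed_topologicalClosure _).mem_of_tendsto hlim
      (Filter.Eventually.of_forall fun n => hg (P n) (hf n))
  · have h1 := hfb n z
    have h2 : ‖MvPolynomial.eval z p * (Complex.exp (MvPolynomial.eval z Q) * g z)‖ ≤ ‖B z‖ := by
      rw [norm_mul, norm_mul, hBn]
      gcongr
      rw [Complex.norm_exp]
      exact Real.exp_le_exp.2 (Complex.re_le_norm _)
    refine (norm_sub_le _ _).trans ?_
    rw [norm_mul 2 (B z), Complex.norm_ofNat]
    linarith
  · simp only [hPev]
    have h := (NormedSpace.expSeries_div_hasSum_exp (MvPolynomial.eval z Q)).tendsto_sum_nat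
    rw [← Complex.exp_eq_exp_ℂ] at h
    exact (h.mul_const _).const_mul _

/-- Up to a scalar factor, the function representing evaluation at `w` on the holomorphic
subspace of `L²(anisoGaussian d A a b)`. -/
def evalKernel {d : ℕ} (a b : ℝ) (w z : Fin d → ℂ) : ℂ :=
  Complex.exp ((a - b) / 4 * sumSq z) *
    Complex.exp (∑ i, (a + b) / 2 * (starRingEnd ℂ) (w i) * z i)

theorem norm_exp_linear_le {d : ℕ} (v z : Fin d → ℂ) :
    ‖Complex.exp (∑ i, v i * z i)‖ ≤ 1 * Real.exp (∑ i, ‖v i‖ * ‖z i‖) := by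
  rw [Complex.norm_exp, one_mul, Real.exp_le_exp]
  refine (Complex.re_le_norm _).trans ((norm_sum_le _ _).trans_eq ?_)
  simp

theorem subordinate_exp_sumSq {d : ℕ} {a b τ δ : ℝ} (hτ0 : 0 ≤ τ) (hτ1 : τ ≤ 1)
    (hδ0 : 0 ≤ δ) (hδ : |a - b| * δ < 2 * min a b) :
    Subordinate (d := d) a b fun z => (Real.exp (|a - b| * δ / 4 * ‖sumSq z‖) : ℂ) *
      Complex.exp (τ * ((a - b) / 4 * sumSq z)) := by
  refine ⟨1, (2 * min a b - |a - b| * δ) / 4, by linarith, fun z => ?_⟩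
  rw [norm_mul, Complex.norm_real, Real.norm_of_nonneg (Real.exp_pos _).le, Complex.norm_exp,
    ← Real.exp_add, one_mul, Real.exp_le_exp]
  have hre : ((τ : ℂ) * (((a : ℂ) - b) / 4 * sumSq z)).re = τ * ((a - b) / 4 * (sumSq z).re) := by
    rw [Complex.re_ofReal_mul]
    have : ((a : ℂ) - b) / 4 = (((a - b) / 4 : ℝ) : ℂ) := by push_cast; ring
    rw [this, Complex.re_ofReal_mul]
  rw [hre, anisoQuad_eq]
  have hn := norm_sumSq_le z
  have hr : |(sumSq z).re| ≤ normSqSum z := (Complex.abs_re_le_norm _).trans hn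
  have hmin : a + b - |a - b| = 2 * min a b := by
    rw [← max_add_min a b, ← max_sub_min_eq_abs']; ring
  have h1 := mul_le_mul_of_nonneg_left hn (mul_nonneg (abs_nonneg (a - b)) hδ0)
  have h2 : -(|a - b| * normSqSum z) ≤ (1 - τ) * ((a - b) * (sumSq z).re) := by
    refine neg_le_of_abs_le ?_
    rw [abs_mul, abs_mul, abs_of_nonneg (sub_nonneg.2 hτ1)]
    refine (mul_le_of_le_one_left (by positivity) (by linarith)).trans ?_
    gcongr
  have h3 : (a + b - |a - b|) * normSqSum z = 2 * min a b * normSqSum z := by rw [hmin]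
  linarith

theorem evalKernel_mem_closure {d : ℕ} {A a b : ℝ} (hA : 0 < A) (ha : 0 < a) (hb : 0 < b)
    (w : Fin d → ℂ) (hm : MemLp (evalKernel a b w) 2 (anisoGaussian d A a b)) :
    hm.toLp _ ∈ (polynomialLp (anisoGaussian d A a b)).topologicalClosure := by
  set v : Fin d → ℂ := fun i => (a + b) / 2 * (starRingEnd ℂ) (w i)
  obtain ⟨N, hN⟩ := exists_nat_gt (|a - b| / (2 * min a b))
  have hmin : 0 < min a b := lt_min ha hb
  have hN0 : (0 : ℝ) < N := lt_of_le_of_lt (by positivity) hN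
  have hδ : |a - b| * (1 / N) < 2 * min a b := by
    rw [div_lt_iff₀ (by positivity)] at hN
    rw [mul_one_div, div_lt_iff₀ hN0]
    linarith
  have hcont : ∀ τ : ℝ, Continuous fun z : Fin d → ℂ =>
      Complex.exp (τ * ((a - b) / 4 * sumSq z)) * Complex.exp (∑ i, v i * z i) := by
    intro τ
    unfold sumSq
    fun_prop
  have key : ∀ j : ℕ, j ≤ N → ∀ (p : MvPolynomial (Fin d) ℂ)
      (hm : MemLp (fun z => MvPolynomial.eval z p *
        (Complex.exp (((j / N : ℝ) : ℂ) * ((a - b) / 4 * sumSq z)) *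
          Complex.exp (∑ i, v i * z i))) 2 (anisoGaussian d A a b)),
      hm.toLp _ ∈ (polynomialLp (anisoGaussian d A a b)).topologicalClosure := by
    intro j
    induction j with
    | zero =>
      intro _ p hm
      have h := mem_closure_exp_mul (a := a) (b := b) hA (g := fun _ => 1) continuous_const
        (∑ i, MvPolynomial.C (v i) * MvPolynomial.X i)
        ((Subordinate.one ha hb).mul_expType (B := 1) (R := fun i => ‖v i‖) fun z => by
          rw [Complex.norm_real, Real.norm_of_nonneg (Real.exp_pos _).le, one_mul,
            Real.exp_le_exp]
          simp only [map_sum, map_mul, MvPolynomial.eval_C, MvPolynomial.eval_X]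
          refine (norm_sum_le _ _).trans_eq ?_
          simp)
        (fun q hq => Submodule.le_topologicalClosure _
          ⟨q, hq.coeFn_toLp.trans (ae_of_all _ fun z => by simp)⟩) p
      simp only [map_sum, map_mul, MvPolynomial.eval_C, MvPolynomial.eval_X, mul_one] at h
      convert! h (by simpa using hm) using 3 with z
      simp
    | succ j ih =>
      intro hj p hm
      have hjN : (j : ℝ) / N ≤ 1 := by
        rw [div_le_one hN0]
        exact_mod_cast (Nat.le_succ j).trans hj
      have hdom := (subordinate_exp_sumSq (d := d) (a := a) (b := b) (τ := j / N) (δ := 1 / N)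
        (by positivity) hjN (by positivity) hδ).mul_expType (norm_exp_linear_le v)
      have hQ : ∀ z : Fin d → ℂ, MvPolynomial.eval z
          (MvPolynomial.C (((a : ℂ) - b) / (4 * N)) * ∑ i, MvPolynomial.X i ^ 2)
          = ((a : ℂ) - b) / (4 * N) * sumSq z := by
        intro z
        simp [sumSq]
      have hQn : ∀ z : Fin d → ℂ, ‖((a : ℂ) - b) / (4 * N) * sumSq z‖
          = |a - b| * (1 / N) / 4 * ‖sumSq z‖ := by
        intro z
        have : ((a : ℂ) - b) / (4 * N) = (((a - b) / (4 * N) : ℝ) : ℂ) := by push_cast; ring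
        rw [norm_mul, this, Complex.norm_real, Real.norm_eq_abs, abs_div,
          abs_of_pos (show (0 : ℝ) < 4 * N by positivity)]
        ring
      have h := mem_closure_exp_mul hA (hcont (j / N))
        (MvPolynomial.C (((a : ℂ) - b) / (4 * N)) * ∑ i, MvPolynomial.X i ^ 2)
        (by
          simp only [hQ, hQn]
          convert hdom using 2 with z
          ring)
        (ih ((Nat.le_succ j).trans hj)) p
      simp only [hQ] at h
      have hN0' : (N : ℂ) ≠ 0 := by exact_mod_cast hN0.ne'
      have heq : ∀ z : Fin d → ℂ, Complex.exp (((a : ℂ) - b) / (4 * N) * sumSq z) *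
          (Complex.exp (((j / N : ℝ) : ℂ) * ((a - b) / 4 * sumSq z)) *
            Complex.exp (∑ i, v i * z i)) =
          Complex.exp ((((j + 1 : ℕ) / N : ℝ) : ℂ) * ((a - b) / 4 * sumSq z)) *
            Complex.exp (∑ i, v i * z i) := by
        intro z
        rw [← mul_assoc, ← Complex.exp_add]
        congr 2
        push_cast
        field_simp
        ring
      simp only [heq] at h
      exact h hm
  have h := key N le_rfl 1
  simp only [div_self hN0.ne', map_one, one_mul, Complex.ofReal_one] at h
  exact h hm

theorem evalKernel_memLp {d : ℕ} {A a b : ℝ} (hA : 0 < A) (ha : 0 < a) (hb : 0 < b)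
    (w : Fin d → ℂ) : MemLp (evalKernel a b w) 2 (anisoGaussian d A a b) := by
  have h := (subordinate_exp_sumSq (d := d) (a := a) (b := b) (τ := 1) (δ := 0)
    zero_le_one le_rfl le_rfl (by simp [ha, hb])).mul_expType
    (norm_exp_linear_le fun i => (a + b) / 2 * (starRingEnd ℂ) (w i))
  refine Subordinate.memLp hA ?_ ?_
  · convert h using 2 with z
    simp [evalKernel, mul_comm]
  · unfold evalKernel sumSq
    fun_prop

theorem gaussian_mul_conj_evalKernel {d : ℕ} (a b : ℝ) (w z : Fin d → ℂ) :
    (Real.exp (-anisoQuad a b (z + w)) : ℂ) * (starRingEnd ℂ) (evalKernel a b w (z + w)) =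
      Complex.exp (-((a - b) / 4 * sumSq (z + w))) *
        Complex.exp (-∑ i, (a + b) / 2 * (starRingEnd ℂ) (w i) * z i) *
        (Real.exp (-((a + b) / 2) * normSqSum z) : ℂ) := by
  have hre : (anisoQuad a b (z + w) : ℂ) = (a + b) / 2 *
      (∑ i, (z i + w i) * (starRingEnd ℂ) (z i + w i)) +
      (a - b) / 4 * (sumSq (z + w) + (starRingEnd ℂ) (sumSq (z + w))) := by
    rw [anisoQuad_eq, Complex.add_conj, normSqSum]
    push_cast
    simp only [Complex.mul_conj, Complex.normSq_eq_norm_sq, Pi.add_apply]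
    push_cast
    ring
  have hS : (normSqSum z : ℂ) = ∑ i, z i * (starRingEnd ℂ) (z i) := by
    simp [normSqSum, Complex.mul_conj, Complex.normSq_eq_norm_sq]
  have hsum : ∑ i, (z i + w i) * (starRingEnd ℂ) (z i + w i) =
      ∑ i, z i * (starRingEnd ℂ) (z i) + ∑ i, (starRingEnd ℂ) (w i) * z i +
        ∑ i, w i * (starRingEnd ℂ) (z i + w i) := by
    simp only [← Finset.sum_add_distrib, map_add]
    exact Finset.sum_congr rfl fun i _ => by ring
  simp only [evalKernel, map_mul, ← Complex.exp_conj, map_sum, Complex.ofReal_exp,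
    ← Complex.exp_add, map_div₀, map_sub, map_add, Complex.conj_ofReal, Complex.conj_conj,
    map_ofNat, mul_assoc, ← Finset.mul_sum, Pi.add_apply, Complex.ofReal_neg]
  congr 1
  simp only [map_add] at hsum hre
  push_cast
  rw [hre, hsum, hS]
  ring

/-- The reproducing property of `evalKernel`. -/
theorem integral_conj_evalKernel_mul {d : ℕ} {A a b : ℝ} (hA : 0 < A) (ha : 0 < a) (hb : 0 < b)
    {H : (Fin d → ℂ) → ℂ} (hH : Differentiable ℂ H) (hH2 : MemLp H 2 (anisoGaussian d A a b))
    (w : Fin d → ℂ) :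
    ∫ z, H z * (starRingEnd ℂ) (evalKernel a b w z) ∂(anisoGaussian d A a b) =
      H w * (A * Complex.exp (-((a - b) / 4 * sumSq w)) *
        ∫ z : Fin d → ℂ, (Real.exp (-((a + b) / 2) * normSqSum z) : ℂ)) := by
  set J : (Fin d → ℂ) → ℂ := fun z => H (z + w) *
    (Complex.exp (-((a - b) / 4 * sumSq (z + w))) *
        Complex.exp (-∑ i, (a + b) / 2 * (starRingEnd ℂ) (w i) * z i)) with hJ
  have hJd : Differentiable ℂ J := by
    simp only [hJ, sumSq, Pi.add_apply]
    fun_prop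
  set G : (Fin d → ℂ) → ℂ := fun z => (A * Real.exp (-anisoQuad a b z)) •
    (H z * (starRingEnd ℂ) (evalKernel a b w z)) with hG
  have hGJ : ∀ z, G (z + w) = A * (J z * (Real.exp (-((a + b) / 2) * normSqSum z) : ℂ)) := by
    intro z
    simp only [hG, hJ, Complex.real_smul]
    rw [mul_assoc (H (z + w)), ← gaussian_mul_conj_evalKernel]
    push_cast
    ring
  have hGint : Integrable G := by
    rw [hG, ← integrable_anisoGaussian_iff hA]
    exact hH2.integrable_mul (evalKernel_memLp hA ha hb w).star
  have hA' : (A : ℂ) ≠ 0 := by exact_mod_cast hA.ne'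
  have hJint : Integrable fun z => J z * (Real.exp (-((a + b) / 2) * normSqSum z) : ℂ) := by
    have h := hGint.comp_add_right w
    simp only [hGJ] at h
    exact (integrable_const_mul_iff hA'.isUnit _).1 h
  rw [integral_anisoGaussian hA, ← integral_add_right_eq_self _ w]
  change ∫ z, G (z + w) = _
  simp only [hGJ]
  rw [integral_const_mul, integral_holomorphic_mul_gaussian hJd hJint]
  simp [hJ]
  ring

theorem differentiable_eval {d : ℕ} (q : MvPolynomial (Fin d) ℂ) :
    Differentiable ℂ fun z => MvPolynomial.eval z q := by
  induction q using MvPolynomial.induction_on with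
  | C w => simp
  | add p q hp hq => simpa using hp.fun_add hq
  | mul_X p i hp =>
    simp only [map_mul, MvPolynomial.eval_X]
    fun_prop

/-- Holomorphic square integrable functions are limits of polynomials. -/
theorem mem_closure_polynomialLp {d : ℕ} {A a b : ℝ} (hA : 0 < A) (ha : 0 < a) (hb : 0 < b)
    {F : (Fin d → ℂ) → ℂ} (hF : Differentiable ℂ F) (hF2 : MemLp F 2 (anisoGaussian d A a b)) :
    hF2.toLp F ∈ (polynomialLp (anisoGaussian d A a b)).topologicalClosure := by
  set μ := anisoGaussian d A a b
  set V := (polynomialLp μ).topologicalClosure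
  have : CompleteSpace V := (Submodule.isClosed_topologicalClosure _).completeSpace_coe
  set E : (Fin d → ℂ) → Lp ℂ 2 μ := fun w => (evalKernel_memLp hA ha hb w).toLp _
  set ρ : (Fin d → ℂ) → ℂ := fun w => A * Complex.exp (-((a - b) / 4 * sumSq w)) *
        ∫ z : Fin d → ℂ, (Real.exp (-((a + b) / 2) * normSqSum z) : ℂ) with hρ
  have hρ0 : ∀ w, ρ w ≠ 0 := by
    intro w
    have h1 : (0 : ℝ) < ∫ z : Fin d → ℂ, Real.exp (-((a + b) / 2) * normSqSum z) :=
      integral_exp_pos (integrable_exp_neg_mul_normSqSum (by positivity))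
    have hA' : (A : ℂ) ≠ 0 := by exact_mod_cast hA.ne'
    simp only [hρ]
    exact mul_ne_zero (mul_ne_zero hA' (Complex.exp_ne_zero _)) (by exact_mod_cast h1.ne')
  have hrep : ∀ (H : (Fin d → ℂ) → ℂ), Differentiable ℂ H → ∀ g : Lp ℂ 2 μ, g =ᵐ[μ] H →
      ∀ w, inner ℂ (E w) g = H w * ρ w := by
    intro H hH g hg w
    have hH2 : MemLp H 2 μ := (memLp_congr_ae hg).1 (Lp.memLp g)
    rw [L2.inner_def, hρ, ← integral_conj_evalKernel_mul hA ha hb hH hH2 w]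
    refine integral_congr_ae ?_
    filter_upwards [(evalKernel_memLp hA ha hb w).coeFn_toLp, hg] with z h1 h2
    rw [RCLike.inner_apply, h1, h2]
  set f := hF2.toLp F
  set g : Lp ℂ 2 μ := V.starProjection f
  have hgV : g ∈ V := Submodule.starProjection_apply_mem _ _
  have hgE : ∀ w, inner ℂ (E w) g = F w * ρ w := by
    intro w
    rw [← hrep F hF f hF2.coeFn_toLp w]
    have hEw : E w ∈ V := evalKernel_mem_closure hA ha hb w _
    have := Submodule.sub_starProjection_mem_orthogonal (K := V) f (E w) hEw
    rw [inner_sub_right, sub_eq_zero] at this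
    exact this.symm
  obtain ⟨u, hu, hlim⟩ := mem_closure_iff_seq_limit.1
    (show g ∈ closure (polynomialLp μ : Set (Lp ℂ 2 μ)) from hgV)
  choose q hq using hu
  have hpt : ∀ w, Filter.Tendsto (fun n => MvPolynomial.eval w (q n)) Filter.atTop
      (nhds (F w)) := by
    intro w
    have h1 : Filter.Tendsto (fun n => inner ℂ (E w) (u n)) Filter.atTop
        (nhds (inner ℂ (E w) g)) := tendsto_const_nhds.inner hlim
    rw [hgE w] at h1
    have h2 : ∀ n, inner ℂ (E w) (u n) = MvPolynomial.eval w (q n) * ρ w := fun n =>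
      hrep (fun z => MvPolynomial.eval z (q n)) (differentiable_eval _) (u n) (hq n) w
    simp only [h2] at h1
    have h3 := h1.mul_const (ρ w)⁻¹
    simpa [mul_assoc, mul_inv_cancel₀ (hρ0 w)] using h3
  obtain ⟨φ, hφ, hae⟩ := (tendstoInMeasure_of_tendsto_Lp hlim).exists_seq_tendsto_ae
  have hfg : g = f := by
    refine Lp.ext ?_
    filter_upwards [hae, hF2.coeFn_toLp, ae_all_iff.2 hq] with z h1 h2 h3
    rw [h2]
    simp only [h3] at h1
    exact tendsto_nhds_unique h1 ((hpt z).comp hφ.tendsto_atTop)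
  rwa [← hfg]

/-- Theorem 3.6, item 4. For `s > t/2 > 0`, the holomorphic polynomial
functions are dense in the holomorphic subspace of `L²(ℂ^d, M_{s,t})`: every holomorphic
`F` with `∫ |F|² dM_{s,t} < ∞` can be `L²(M_{s,t})`-approximated by polynomials. -/
theorem holomorphic_polynomials_dense
    (d : ℕ) (hd : 1 ≤ d) (s t : ℝ) (ht : 0 < t / 2) (hst : t / 2 < s)
    (F : (Fin d → ℂ) → ℂ) (hF : Differentiable ℂ F)
    (hF2 : ∫⁻ z : Fin d → ℂ, (‖F z‖₊ : ℝ≥0∞) ^ 2 ∂(MMeasure d s t) < ⊤) :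
    ∀ ε : ℝ, 0 < ε → ∃ q : MvPolynomial (Fin d) ℂ,
      ∫ z : Fin d → ℂ, ‖F z - MvPolynomial.eval z q‖ ^ 2 ∂(MMeasure d s t) < ε := by
  intro ε hε
  set A : ℝ := (Real.pi * (2 * (s - t / 2))) ^ (-(d : ℝ) / 2) *
    (Real.pi * t) ^ (-(d : ℝ) / 2) with hAdef
  have ht' : 0 < t := by linarith
  have hr : 0 < 2 * (s - t / 2) := by linarith
  have hA : 0 < A := by positivity
  have hM : MMeasure d s t = anisoGaussian d A (2 * (s - t / 2))⁻¹ t⁻¹ := by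
    unfold MMeasure anisoGaussian
    congr 1
    ext z
    simp only [MDensity, anisoQuad, hAdef]
    congr 3
    rw [neg_div, div_eq_inv_mul, div_eq_inv_mul]
    ring
  rw [hM] at hF2 ⊢
  set μ := anisoGaussian d A (2 * (s - t / 2))⁻¹ t⁻¹
  have hFL : MemLp F 2 μ := by
    refine ⟨hF.continuous.aestronglyMeasurable, ?_⟩
    rw [eLpNorm_lt_top_iff_lintegral_rpow_enorm_lt_top two_ne_zero ENNReal.ofNat_ne_top]
    simpa [enorm_eq_nnnorm] using hF2
  have hmem := mem_closure_polynomialLp hA (inv_pos.2 hr) (inv_pos.2 ht') hF hFL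
  obtain ⟨g, ⟨q, hq⟩, hdist⟩ := Metric.mem_closure_iff.1
    (show hFL.toLp F ∈ closure (polynomialLp μ : Set (Lp ℂ 2 μ)) from hmem) (√ε)
    (Real.sqrt_pos.2 hε)
  refine ⟨q, ?_⟩
  have hnorm : ∫ z, ‖F z - MvPolynomial.eval z q‖ ^ 2 ∂μ = ‖hFL.toLp F - g‖ ^ 2 := by
    rw [← inner_self_eq_norm_sq (𝕜 := ℂ), L2.inner_def]
    have h : ∫ z, inner ℂ ((hFL.toLp F - g) z) ((hFL.toLp F - g) z) ∂μ =
        ∫ z, ((‖F z - MvPolynomial.eval z q‖ ^ 2 : ℝ) : ℂ) ∂μ := by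
      refine integral_congr_ae ?_
      filter_upwards [Lp.coeFn_sub (hFL.toLp F) g, hFL.coeFn_toLp, hq] with z h1 h2 h3
      rw [inner_self_eq_norm_sq_to_K, h1, Pi.sub_apply, h2, h3]
      simp
    rw [h, integral_complex_ofReal]
    rfl
  rw [hnorm, ← dist_eq_norm]
  calc dist (hFL.toLp F) g ^ 2 < √ε ^ 2 := by gcongr
    _ = ε := Real.sq_sqrt hε.le
end
end

section
/- Fix an integer d ≥ 1 and real numbers s, t. For smooth functions u : ℂ^d → ℂ (viewing ℂ^d ≅ ℝ^{2d} with coordinates z_k = x_k + i y_k), let A_{s,t}u = (s − t/2) Σ_{k=1}^d ∂²u/∂x_k² + (t/2) Σ_{k=1}^d ∂²u/∂y_k². Then for all holomorphic functions f, g : ℂ^d → ℂ and every point of ℂ^d: A_{s,t}(conj(f)·g) − conj(A_{s,t}f)·g − conj(f)·(A_{s,t}g) = 2s Σ_{k=1}^d conj(∂f/∂x_k) · (∂g/∂x_k). -/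
open MeasureTheory ENNReal

noncomputable section


/-- The real partial derivative `∂u/∂x_k` (in the real part of the `k`-th complex
coordinate) of a function on `ℂ^d`. -/
def pdx (d : ℕ) (k : Fin d) (u : (Fin d → ℂ) → ℂ) : (Fin d → ℂ) → ℂ :=
  fun z => fderiv ℝ u z (Pi.single k 1)

/-- The real partial derivative `∂u/∂y_k` (in the imaginary part of the `k`-th complex
coordinate) of a function on `ℂ^d`. -/
def pdy (d : ℕ) (k : Fin d) (u : (Fin d → ℂ) → ℂ) : (Fin d → ℂ) → ℂ :=
  fun z => fderiv ℝ u z (Pi.single k Complex.I)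

/-- The operator `A_{s,t} = (s - t/2) Σ_k ∂²/∂x_k² + (t/2) Σ_k ∂²/∂y_k²` on `ℂ^d`. -/
def Aop (d : ℕ) (s t : ℝ) (u : (Fin d → ℂ) → ℂ) : (Fin d → ℂ) → ℂ :=
  fun z => ((s - t / 2 : ℝ) : ℂ) * ∑ k, pdx d k (pdx d k u) z
    + ((t / 2 : ℝ) : ℂ) * ∑ k, pdy d k (pdy d k u) z

/-- Cauchy estimate: the derivative of an entire function on a finite-dimensional space is bounded
on bounded sets. -/
lemma exists_norm_fderiv_le_of_differentiable {E : Type*} [NormedAddCommGroup E] [NormedSpace ℂ E]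
    [FiniteDimensional ℂ E] {f : E → ℂ} (hf : Differentiable ℂ f) (R : ℝ) :
    ∃ C, ∀ z ∈ Metric.closedBall (0 : E) R, ‖fderiv ℂ f z‖ ≤ C := by
  have : ProperSpace E := FiniteDimensional.proper ℂ E
  obtain ⟨C, hC⟩ := (isCompact_closedBall (0 : E) (R + 1)).exists_bound_of_continuousOn
    hf.continuous.continuousOn
  refine ⟨max C 0, fun z hz => ContinuousLinearMap.opNorm_le_bound _ (le_max_right _ _) fun u => ?_⟩
  rcases eq_or_ne u 0 with rfl | hu
  · simp
  have hu' : 0 < ‖u‖ := norm_pos_iff.2 hu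
  have hline : Differentiable ℂ fun ζ : ℂ => f (z + ζ • u) := by fun_prop
  have hderiv : deriv (fun ζ : ℂ => f (z + ζ • u)) 0 = fderiv ℂ f z u :=
    (hf z).lineDeriv_eq_fderiv
  have hle := Complex.norm_deriv_le_of_forall_mem_sphere_norm_le (c := 0) (C := max C 0)
    (inv_pos.2 hu') hline.diffContOnCl fun ζ hζ => by
      refine (hC _ ?_).trans (le_max_left _ _)
      rw [mem_sphere_zero_iff_norm] at hζ
      rw [mem_closedBall_zero_iff] at hz ⊢
      refine (norm_add_le _ _).trans ?_
      rw [norm_smul, hζ, inv_mul_cancel₀ hu'.ne']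
      gcongr
  rwa [hderiv, div_inv_eq_mul] at hle

/-- Averaging translates of an entire function along a bounded path gives an entire function. -/
lemma differentiable_intervalIntegral_mul_comp_add {E : Type*} [NormedAddCommGroup E]
    [NormedSpace ℂ E] [FiniteDimensional ℂ E] {f : E → ℂ} (hf : Differentiable ℂ f)
    {c : ℝ → ℂ} (hc : Continuous c) {p : ℝ → E} (hp : Continuous p) {M : ℝ}
    (hM : ∀ θ, ‖p θ‖ ≤ M) (a b : ℝ) :
    Differentiable ℂ fun z => ∫ θ in a..b, c θ * f (z + p θ) := by
  intro z₀
  borelize E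
  have : ProperSpace E := FiniteDimensional.proper ℂ E
  have : SecondCountableTopology (E →L[ℂ] ℂ) :=
    have : ProperSpace (E →L[ℂ] ℂ) := FiniteDimensional.proper ℂ _
    inferInstance
  obtain ⟨C, hC⟩ := exists_norm_fderiv_le_of_differentiable hf (‖z₀‖ + 1 + M)
  have hcont : ∀ z, Continuous fun θ => c θ * f (z + p θ) := fun z =>
    hc.mul (hf.continuous.comp (continuous_const.add hp))
  refine (intervalIntegral.hasFDerivAt_integral_of_dominated_of_fderiv_le
    (F' := fun z θ => c θ • fderiv ℂ f (z + p θ)) (bound := fun θ => ‖c θ‖ * C)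
    (Metric.ball_mem_nhds z₀ one_pos) (.of_forall fun z => (hcont z).aestronglyMeasurable)
    ((hcont z₀).intervalIntegrable _ _) ?_ (.of_forall fun θ _ z hz => ?_)
    ((hc.norm.mul continuous_const).intervalIntegrable _ _)
    (.of_forall fun θ _ z _ => ?_)).differentiableAt
  · exact (hc.measurable.smul ((measurable_fderiv ℂ f).comp
      (continuous_const.add hp).measurable)).aestronglyMeasurable
  · rw [norm_smul]
    gcongr
    refine hC _ (mem_closedBall_zero_iff.2 ((norm_add_le _ _).trans (add_le_add ?_ (hM θ))))
    have h := norm_add_le z₀ (z - z₀)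
    rw [add_sub_cancel] at h
    rw [mem_ball_iff_norm] at hz
    linarith
  · have h := (hf (z + p θ)).hasFDerivAt.comp z ((hasFDerivAt_id z).add_const (p θ))
    exact h.const_mul (c θ)

/-- Directional derivatives of an entire function on a finite-dimensional space are entire. -/
lemma differentiable_fderiv_apply_of_differentiable {E : Type*} [NormedAddCommGroup E]
    [NormedSpace ℂ E] [FiniteDimensional ℂ E] {f : E → ℂ} (hf : Differentiable ℂ f) (v : E) :
    Differentiable ℂ fun z => fderiv ℂ f z v := by
  have hformula : (fun z => fderiv ℂ f z v) = fun z => (2 * Real.pi * Complex.I : ℂ)⁻¹ *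
      ∫ θ in (0 : ℝ)..2 * Real.pi, (circleMap 0 1 θ * Complex.I * (circleMap 0 1 θ ^ 2)⁻¹) *
        f (z + circleMap 0 1 θ • v) := by
    funext z
    have hline : Differentiable ℂ fun ζ : ℂ => f (z + ζ • v) := by fun_prop
    have hderiv : deriv (fun ζ : ℂ => f (z + ζ • v)) 0 = fderiv ℂ f z v :=
      (hf z).lineDeriv_eq_fderiv
    rw [← hderiv, ← Complex.two_pi_I_inv_smul_circleIntegral_sub_sq_inv_smul_of_differentiable
      isOpen_univ (Set.subset_univ (Metric.closedBall (0 : ℂ) 1)) hline.differentiableOn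
      (Metric.mem_ball_self one_pos)]
    simp [circleIntegral, mul_assoc]
  rw [hformula]
  refine (differentiable_intervalIntegral_mul_comp_add hf ?_ ?_ (M := ‖v‖) ?_ _ _).const_mul _
  · refine ((continuous_circleMap 0 1).mul continuous_const).mul
      (((continuous_circleMap 0 1).pow 2).inv₀ fun θ => ?_)
    exact pow_ne_zero 2 (circleMap_ne_center one_ne_zero)
  · exact (continuous_circleMap 0 1).smul continuous_const
  · intro θ
    simp [norm_smul]

lemma fderiv_conj_mul_apply {E : Type*} [NormedAddCommGroup E] [NormedSpace ℝ E] {f g : E → ℂ}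
    {z : E} (hf : DifferentiableAt ℝ f z) (hg : DifferentiableAt ℝ g z) (v : E) :
    fderiv ℝ (fun w => (starRingEnd ℂ) (f w) * g w) z v =
      (starRingEnd ℂ) (fderiv ℝ f z v) * g z + (starRingEnd ℂ) (f z) * fderiv ℝ g z v := by
  have hconj : HasFDerivAt (fun w => (starRingEnd ℂ) (f w))
      ((Complex.conjCLE : ℂ →L[ℝ] ℂ).comp (fderiv ℝ f z)) z :=
    (Complex.conjCLE : ℂ →L[ℝ] ℂ).hasFDerivAt.comp z hf.hasFDerivAt
  rw [(hconj.fun_mul hg.hasFDerivAt).fderiv]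
  simp
  ring

/-- Second-order Leibniz rule for `conj f * g` along a direction `v`. -/
lemma fderiv_fderiv_conj_mul_apply {E : Type*} [NormedAddCommGroup E] [NormedSpace ℝ E]
    {f g : E → ℂ} (v : E) (hf : Differentiable ℝ f) (hg : Differentiable ℝ g)
    (hf' : Differentiable ℝ fun z => fderiv ℝ f z v)
    (hg' : Differentiable ℝ fun z => fderiv ℝ g z v) (z : E) :
    fderiv ℝ (fun x => fderiv ℝ (fun w => (starRingEnd ℂ) (f w) * g w) x v) z v =
      (starRingEnd ℂ) (fderiv ℝ (fun x => fderiv ℝ f x v) z v) * g z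
        + 2 * ((starRingEnd ℂ) (fderiv ℝ f z v) * fderiv ℝ g z v)
        + (starRingEnd ℂ) (f z) * fderiv ℝ (fun x => fderiv ℝ g x v) z v := by
  have hconj : ∀ {h : E → ℂ}, Differentiable ℝ h →
      Differentiable ℝ fun w => (starRingEnd ℂ) (h w) := fun hh =>
    (Complex.conjCLE : ℂ →L[ℝ] ℂ).differentiable.comp hh
  have hfirst : (fun x => fderiv ℝ (fun w => (starRingEnd ℂ) (f w) * g w) x v) = fun x =>
      (starRingEnd ℂ) (fderiv ℝ f x v) * g x + (starRingEnd ℂ) (f x) * fderiv ℝ g x v :=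
    funext fun x => fderiv_conj_mul_apply (hf x) (hg x) v
  rw [hfirst, fderiv_fun_add (((hconj hf').fun_mul hg) z) (((hconj hf).fun_mul hg') z),
    add_apply, fderiv_conj_mul_apply (hf' z) (hg z),
    fderiv_conj_mul_apply (hf z) (hg' z)]
  ring

lemma differentiable_fderiv_real_apply {d : ℕ} {f : (Fin d → ℂ) → ℂ} (hf : Differentiable ℂ f)
    (v : Fin d → ℂ) : Differentiable ℝ fun z => fderiv ℝ f z v := by
  have h : (fun z => fderiv ℝ f z v) = fun z => fderiv ℂ f z v := by
    funext z
    rw [(hf z).fderiv_restrictScalars ℝ]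
    rfl
  rw [h]
  exact (differentiable_fderiv_apply_of_differentiable hf v).restrictScalars ℝ

/-- The Cauchy–Riemann equations `∂f/∂y_k = i ∂f/∂x_k`. -/
lemma pdy_eq_I_mul_pdx {d : ℕ} {f : (Fin d → ℂ) → ℂ} (hf : Differentiable ℂ f) (k : Fin d)
    (z : Fin d → ℂ) : pdy d k f z = Complex.I * pdx d k f z := by
  have hI : (Pi.single k Complex.I : Fin d → ℂ) = Complex.I • Pi.single k 1 := by
    rw [← Pi.single_smul, smul_eq_mul, mul_one]
  simp only [pdx, pdy, (hf z).fderiv_restrictScalars ℝ,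
    ContinuousLinearMap.coe_restrictScalars', hI, map_smul, smul_eq_mul]

/-- For holomorphic `f, g : ℂ^d → ℂ` and all `s, t`, at every point:
`A_{s,t}(conj(f)·g) - conj(A_{s,t}f)·g - conj(f)·A_{s,t}g = 2s Σ_k conj(∂f/∂x_k)·(∂g/∂x_k)`. -/
theorem Aop_product_rule_holomorphic
    (d : ℕ) (hd : 1 ≤ d) (s t : ℝ)
    (f g : (Fin d → ℂ) → ℂ) (hf : Differentiable ℂ f) (hg : Differentiable ℂ g) :
    ∀ z : Fin d → ℂ,
      Aop d s t (fun w => (starRingEnd ℂ) (f w) * g w) z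
          - (starRingEnd ℂ) (Aop d s t f z) * g z
          - (starRingEnd ℂ) (f z) * Aop d s t g z
        = ((2 * s : ℝ) : ℂ) * ∑ k, (starRingEnd ℂ) (pdx d k f z) * pdx d k g z := by
  intro z
  have hx : ∀ k, pdx d k (pdx d k fun w => (starRingEnd ℂ) (f w) * g w) z =
      (starRingEnd ℂ) (pdx d k (pdx d k f) z) * g z
        + 2 * ((starRingEnd ℂ) (pdx d k f z) * pdx d k g z)
        + (starRingEnd ℂ) (f z) * pdx d k (pdx d k g) z := fun k =>
    fderiv_fderiv_conj_mul_apply _ (hf.restrictScalars ℝ) (hg.restrictScalars ℝ)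
      (differentiable_fderiv_real_apply hf _) (differentiable_fderiv_real_apply hg _) z
  have hy : ∀ k, pdy d k (pdy d k fun w => (starRingEnd ℂ) (f w) * g w) z =
      (starRingEnd ℂ) (pdy d k (pdy d k f) z) * g z
        + 2 * ((starRingEnd ℂ) (pdx d k f z) * pdx d k g z)
        + (starRingEnd ℂ) (f z) * pdy d k (pdy d k g) z := fun k => by
    have hcross : (starRingEnd ℂ) (pdy d k f z) * pdy d k g z =
        (starRingEnd ℂ) (pdx d k f z) * pdx d k g z := by
      rw [pdy_eq_I_mul_pdx hf, pdy_eq_I_mul_pdx hg, map_mul, Complex.conj_I]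
      linear_combination (-(starRingEnd ℂ) (pdx d k f z) * pdx d k g z) * Complex.I_mul_I
    rw [← hcross]
    exact fderiv_fderiv_conj_mul_apply _ (hf.restrictScalars ℝ) (hg.restrictScalars ℝ)
      (differentiable_fderiv_real_apply hf _) (differentiable_fderiv_real_apply hg _) z
  simp only [Aop, hx, hy, Finset.sum_add_distrib, ← Finset.mul_sum, ← Finset.sum_mul, map_add,
    map_mul, Complex.conj_ofReal, map_sum]
  push_cast
  ring
end
end

section
/- Let k : ℝ × ℝ → ℝ be twice continuously differentiable, let (V_i)_{i ∈ ι} be a Hilbert basis of the real Hilbert space L²([0,1], ℝ) with Lebesgue measure, and let t ∈ [0,1]. Then the family ( ∫_{[0,t]²} 1_{{r ≤ τ}} k(r, τ) V_i(r) V_i(τ) dr dτ )_{i ∈ ι} is summable and Σ_{i ∈ ι} ∫_{[0,t]²} 1_{{r ≤ τ}} k(r, τ) V_i(r) V_i(τ) dr dτ = (1/2) ∫_0^t k(τ, τ) dτ. -/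
open MeasureTheory

noncomputable section


theorem Orthonormal.countable_of_separableSpace {ι E : Type*} [NormedAddCommGroup E]
    [InnerProductSpace ℝ E] [TopologicalSpace.SeparableSpace E] {v : ι → E}
    (hv : Orthonormal ℝ v) : Countable ι := by
  have h (i : ι) : ∃ n, dist (v i) (TopologicalSpace.denseSeq E n) < 1 / 2 :=
    (TopologicalSpace.denseRange_denseSeq E).exists_dist_lt (v i) (by norm_num)
  choose n hn using h
  refine Function.Injective.countable (f := n) fun i j hij => ?_
  by_contra hne
  have hlt : ‖v i - v j‖ < 1 := by
    rw [← dist_eq_norm]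
    have hj := hn j
    rw [← hij] at hj
    linarith [dist_triangle_right (v i) (v j) (TopologicalSpace.denseSeq E (n i)), hn i]
  have hsq := norm_sub_sq_real (v i) (v j)
  rw [hv.1 i, hv.1 j, hv.2 hne] at hsq
  nlinarith [norm_nonneg (v i - v j)]

theorem MeasureTheory.Lp.inner_toLp_right {X : Type*} [MeasurableSpace X] {μ : Measure X}
    (u : Lp ℝ 2 μ) {f : X → ℝ} (hf : MemLp f 2 μ) :
    inner ℝ u (hf.toLp f) = ∫ x, f x * u x ∂μ := by
  rw [L2.inner_def]
  refine integral_congr_ae ?_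
  filter_upwards [hf.coeFn_toLp] with x hx
  rw [hx]
  rfl

theorem MeasureTheory.MemLp.inner_toLp_toLp {X : Type*} [MeasurableSpace X] {μ : Measure X}
    {f g : X → ℝ} (hf : MemLp f 2 μ) (hg : MemLp g 2 μ) :
    inner ℝ (hf.toLp f) (hg.toLp g) = ∫ x, f x * g x ∂μ := by
  rw [Lp.inner_toLp_right]
  refine integral_congr_ae ?_
  filter_upwards [hf.coeFn_toLp] with x hx
  rw [hx, mul_comm]

/-- The trace formula for a composition of two Hilbert-Schmidt integral operators with bounded
kernels. -/
theorem HilbertBasis.hasSum_integral_kernel {ι X S : Type*} [MeasurableSpace X]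
    [MeasurableSpace S] {μ : Measure X} [IsFiniteMeasure μ] {ν : Measure S} [IsFiniteMeasure ν]
    [Countable ι] (V : HilbertBasis ι ℝ (Lp ℝ 2 μ)) {F G : S → X → ℝ}
    (hF : Measurable (Function.uncurry F)) (hG : Measurable (Function.uncurry G)) {A B : ℝ}
    (hFA : ∀ s x, |F s x| ≤ A) (hGB : ∀ s x, |G s x| ≤ B) :
    HasSum (fun i => ∫ p, (∫ s, F s p.1 * G s p.2 ∂ν) * (V i p.1 * V i p.2) ∂(μ.prod μ))
      (∫ x, ∫ s, F s x * G s x ∂ν ∂μ) := by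
  have memF (s : S) : MemLp (F s) 2 μ :=
    .of_bound (hF.comp measurable_prodMk_left).aestronglyMeasurable A (.of_forall (hFA s))
  have memG (s : S) : MemLp (G s) 2 μ :=
    .of_bound (hG.comp measurable_prodMk_left).aestronglyMeasurable B (.of_forall (hGB s))
  have mul_bound {a b a' b' : ℝ} (h : |a| ≤ a') (h' : |b| ≤ b') : ‖a * b‖ ≤ a' * b' := by
    rw [Real.norm_eq_abs, abs_mul]
    gcongr
    exact (abs_nonneg a).trans h
  have measV (i : ι) : StronglyMeasurable (V i) := Lp.stronglyMeasurable _
  have intV (i : ι) : Integrable (V i) μ := (Lp.memLp (V i)).integrable one_le_two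
  have measInner {H : S → X → ℝ} (hH : Measurable (Function.uncurry H)) (i : ι) :
      StronglyMeasurable fun s => ∫ x, H s x * V i x ∂μ :=
    StronglyMeasurable.integral_prod_right'
      (f := fun p : S × X => H p.1 p.2 * V i p.2)
      (hH.stronglyMeasurable.mul ((measV i).comp_measurable measurable_snd))
  have intSq {H : S → X → ℝ} (hH : Measurable (Function.uncurry H)) {C : ℝ}
      (hC : ∀ s x, |H s x| ≤ C) : Integrable (fun s => ∫ x, H s x * H s x ∂μ) ν := by
    refine Integrable.integral_prod_left (f := fun p : S × X => H p.1 p.2 * H p.1 p.2) ?_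
    exact .of_bound (hH.mul hH).aestronglyMeasurable (C * C)
      (.of_forall fun p => mul_bound (hC _ _) (hC _ _))
  have parseval {H K : S → X → ℝ} (hH : ∀ s, MemLp (H s) 2 μ) (hK : ∀ s, MemLp (K s) 2 μ)
      (s : S) : HasSum (fun i => (∫ x, H s x * V i x ∂μ) * ∫ x, K s x * V i x ∂μ)
        (∫ x, H s x * K s x ∂μ) := by
    have h := V.hasSum_inner_mul_inner ((hH s).toLp) ((hK s).toLp)
    rw [MemLp.inner_toLp_toLp] at h
    simpa only [real_inner_comm (V _) ((hH s).toLp), Lp.inner_toLp_right] using h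
  have sumBound (s : S) : HasSum
      (fun i => ((∫ x, F s x * V i x ∂μ) ^ 2 + (∫ x, G s x * V i x ∂μ) ^ 2) / 2)
      (((∫ x, F s x * F s x ∂μ) + ∫ x, G s x * G s x ∂μ) / 2) :=
    by simpa only [sq] using ((parseval memF memF s).add (parseval memG memG s)).div_const 2
  have key : HasSum (fun i => ∫ s, (∫ x, F s x * V i x ∂μ) * (∫ x, G s x * V i x ∂μ) ∂ν)
      (∫ s, ∫ x, F s x * G s x ∂μ ∂ν) := by
    refine hasSum_integral_of_dominated_convergence
      (fun i s => ((∫ x, F s x * V i x ∂μ) ^ 2 + (∫ x, G s x * V i x ∂μ) ^ 2) / 2)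
      (fun i => ((measInner hF i).mul (measInner hG i)).aestronglyMeasurable)
      (fun i => .of_forall fun s => ?_) (.of_forall fun s => (sumBound s).summable) ?_
      (.of_forall fun s => ?_)
    · rw [Real.norm_eq_abs, abs_le]
      constructor <;>
        nlinarith [sq_nonneg ((∫ x, F s x * V i x ∂μ) + ∫ x, G s x * V i x ∂μ),
          sq_nonneg ((∫ x, F s x * V i x ∂μ) - ∫ x, G s x * V i x ∂μ)]
    · simp_rw [(sumBound _).tsum_eq]
      exact ((intSq hF hFA).add (intSq hG hGB)).div_const 2
    · exact parseval memF memG s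
  have swap : ∫ s, ∫ x, F s x * G s x ∂μ ∂ν = ∫ x, ∫ s, F s x * G s x ∂ν ∂μ := by
    refine integral_integral_swap ?_
    exact .of_bound (hF.mul hG).aestronglyMeasurable (A * B)
      (.of_forall fun p => mul_bound (hFA _ _) (hGB _ _))
  rw [swap] at key
  convert! key using 2 with i
  have intVV : Integrable (fun p : X × X => V i p.1 * V i p.2) (μ.prod μ) :=
    (intV i).mul_prod (intV i)
  have intAll : Integrable (Function.uncurry fun (p : X × X) (s : S) =>
      (F s p.1 * G s p.2) * (V i p.1 * V i p.2)) ((μ.prod μ).prod ν) := by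
    refine Integrable.bdd_mul (c := A * B) (intVV.comp_fst ν) ?_
      (.of_forall fun q => mul_bound (hFA q.2 q.1.1) (hGB q.2 q.1.2))
    have hF' : Measurable fun q : (X × X) × S => F q.2 q.1.1 :=
      hF.comp (measurable_snd.prodMk measurable_fst.fst)
    have hG' : Measurable fun q : (X × X) × S => G q.2 q.1.2 :=
      hG.comp (measurable_snd.prodMk measurable_fst.snd)
    exact (hF'.mul hG').aestronglyMeasurable
  refine (integral_congr_ae (.of_forall fun p => (integral_mul_const _ _).symm)).trans ?_
  rw [integral_integral_swap intAll]
  refine integral_congr_ae (.of_forall fun s => ?_)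
  simp only
  rw [← integral_prod_mul]
  refine integral_congr_ae (.of_forall fun p => ?_)
  ring
theorem MeasureTheory.integral_upper_triangle_mul_eq_half {ρ : Measure ℝ} [SFinite ρ] [NullSingletonClass ρ]
    {k : ℝ × ℝ → ℝ} {v : ℝ → ℝ}
    (hint : Integrable (fun p : ℝ × ℝ => (if p.1 ≤ p.2 then k p else 0) * v p.1 * v p.2)
      (ρ.prod ρ)) :
    ∫ p, (if p.1 ≤ p.2 then k p else 0) * v p.1 * v p.2 ∂(ρ.prod ρ)
      = (1 / 2) * ∫ p, k (min p.1 p.2, max p.1 p.2) * (v p.1 * v p.2) ∂(ρ.prod ρ) := by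
  have hdiag : ∀ᵐ p : ℝ × ℝ ∂(ρ.prod ρ), p.1 ≠ p.2 := by
    have hmeas : MeasurableSet {p : ℝ × ℝ | p.1 = p.2} :=
      measurableSet_eq_fun measurable_fst measurable_snd
    have hnull : ρ.prod ρ {p : ℝ × ℝ | p.1 = p.2} = 0 := by
      rw [Measure.measure_prod_null hmeas]
      refine .of_forall fun x => ?_
      have : Prod.mk x ⁻¹' {p : ℝ × ℝ | p.1 = p.2} = {x} := by
        ext y
        simp [eq_comm]
      simp [this]
    exact measure_eq_zero_iff_ae_notMem.mp hnull
  set f : ℝ × ℝ → ℝ := fun p => (if p.1 ≤ p.2 then k p else 0) * v p.1 * v p.2 with hf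
  have hsum : ∫ p, k (min p.1 p.2, max p.1 p.2) * (v p.1 * v p.2) ∂(ρ.prod ρ)
      = ∫ p, (f p + f p.swap) ∂(ρ.prod ρ) := by
    refine integral_congr_ae ?_
    filter_upwards [hdiag] with ⟨x, y⟩ hxy
    rcases lt_or_gt_of_ne hxy with h | h
    · simp [hf, h.le, h.not_ge, mul_assoc]
    · simp [hf, h.le, h.not_ge]
      ring
  have hadd : ∫ p, (f p + f p.swap) ∂(ρ.prod ρ) = _ := integral_add hint hint.swap
  rw [hsum, hadd, integral_prod_swap f]
  ring

/-- The partial derivative in `s` of `(s, τ) ↦ k (min s τ, max s τ)` off the diagonal, extended to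
`s < 0` by `k (0, τ)`. -/
def diagonalDensity (k : ℝ × ℝ → ℝ) (s τ : ℝ) : ℝ :=
  if s < 0 then k (0, τ) else
    if s ≤ τ then fderiv ℝ k (s, τ) (1, 0) else fderiv ℝ k (τ, s) (0, 1)

theorem measurable_diagonalDensity {k : ℝ × ℝ → ℝ} (hk : ContDiff ℝ 1 k) :
    Measurable (Function.uncurry (diagonalDensity k)) := by
  have hd : Continuous (fderiv ℝ k) := hk.continuous_fderiv one_ne_zero
  have hc : Continuous k := hk.continuous
  refine Measurable.ite (measurableSet_lt measurable_fst measurable_const) ?_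
    (Measurable.ite (measurableSet_le measurable_fst measurable_snd) ?_ ?_)
  all_goals exact Continuous.measurable (by fun_prop)

theorem exists_abs_diagonalDensity_le {k : ℝ × ℝ → ℝ} (hk : ContDiff ℝ 1 k) :
    ∃ C, ∀ s ∈ Set.Icc (-1 : ℝ) 1, ∀ τ ∈ Set.Icc (0 : ℝ) 1, |diagonalDensity k s τ| ≤ C := by
  have hd : Continuous (fderiv ℝ k) := hk.continuous_fderiv one_ne_zero
  have hc : Continuous k := hk.continuous
  have hQ : IsCompact (Set.Icc (0 : ℝ) 1 ×ˢ Set.Icc (0 : ℝ) 1) := isCompact_Icc.prod isCompact_Icc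
  obtain ⟨C, hC⟩ := hQ.exists_bound_of_continuousOn (f := fun p : ℝ × ℝ =>
    |k p| + |fderiv ℝ k p (1, 0)| + |fderiv ℝ k p (0, 1)|) (by fun_prop)
  have hC' (a b : ℝ) (ha : a ∈ Set.Icc (0 : ℝ) 1) (hb : b ∈ Set.Icc (0 : ℝ) 1) :=
    (le_abs_self _).trans (hC (a, b) ⟨ha, hb⟩)
  refine ⟨C, fun s hs τ hτ => ?_⟩
  unfold diagonalDensity
  split_ifs with h0 h1
  · have := hC' 0 τ (by simp) hτ
    linarith [abs_nonneg (fderiv ℝ k (0, τ) (1, 0)), abs_nonneg (fderiv ℝ k (0, τ) (0, 1))]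
  · have := hC' s τ ⟨not_lt.mp h0, hs.2⟩ hτ
    linarith [abs_nonneg (k (s, τ)), abs_nonneg (fderiv ℝ k (s, τ) (0, 1))]
  · have := hC' τ s hτ ⟨not_lt.mp h0, hs.2⟩
    linarith [abs_nonneg (k (τ, s)), abs_nonneg (fderiv ℝ k (τ, s) (1, 0))]

theorem integral_diagonalDensity {k : ℝ × ℝ → ℝ} (hk : ContDiff ℝ 1 k) {r τ : ℝ}
    (hr : r ∈ Set.Icc (0 : ℝ) 1) (hτ : τ ∈ Set.Icc (0 : ℝ) 1) :
    ∫ s in (-1)..r, diagonalDensity k s τ = k (min r τ, max r τ) := by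
  have hc : Continuous k := hk.continuous
  have hderiv (p : ℝ × ℝ) : HasFDerivAt k (fderiv ℝ k p) p :=
    (hk.differentiable one_ne_zero p).hasFDerivAt
  obtain ⟨C, hC⟩ := exists_abs_diagonalDensity_le hk
  have hle : (-1 : ℝ) ≤ r := by linarith [hr.1]
  have hftc := MeasureTheory.integral_eq_of_hasDerivAt_off_countable_of_le
    (fun s => min 0 s * k (0, τ) + k (min (max s 0) τ, max (max s 0) τ))
    (fun s => diagonalDensity k s τ) hle ((Set.countable_singleton τ).insert 0)
    (by fun_prop) ?_ ?_
  · rw [hftc]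
    simp [hr.1, hτ.1]
  · rintro s ⟨-, hs⟩
    simp only [Set.mem_insert_iff, Set.mem_singleton_iff, not_or] at hs
    rcases lt_or_gt_of_ne hs.1 with h0 | h0
    · have : HasDerivAt (fun s => s * k (0, τ) + k (0, τ)) (k (0, τ)) s := by
        simpa using ((hasDerivAt_id s).mul_const (k (0, τ))).add_const (k (0, τ))
      rw [diagonalDensity, if_pos h0]
      refine this.congr_of_eventuallyEq ?_
      filter_upwards [Iio_mem_nhds h0] with x hx
      simp [le_of_lt (Set.mem_Iio.mp hx), hτ.1]
    rcases lt_or_gt_of_ne hs.2 with h1 | h1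
    · have : HasDerivAt (fun s => k (s, τ)) (fderiv ℝ k (s, τ) (1, 0)) s :=
        (hderiv (s, τ)).comp_hasDerivAt s ((hasDerivAt_id s).prodMk (hasDerivAt_const s τ))
      rw [diagonalDensity, if_neg h0.not_gt, if_pos h1.le]
      refine this.congr_of_eventuallyEq ?_
      filter_upwards [Ioo_mem_nhds h0 h1] with x hx
      simp [hx.1.le, hx.2.le]
    · have : HasDerivAt (fun s => k (τ, s)) (fderiv ℝ k (τ, s) (0, 1)) s :=
        (hderiv (τ, s)).comp_hasDerivAt s ((hasDerivAt_const s τ).prodMk (hasDerivAt_id s))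
      rw [diagonalDensity, if_neg h0.not_gt, if_neg h1.not_ge]
      refine this.congr_of_eventuallyEq ?_
      filter_upwards [Ioi_mem_nhds h0, Ioi_mem_nhds h1] with x hx hx'
      simp [le_of_lt (Set.mem_Ioi.mp hx), le_of_lt (Set.mem_Ioi.mp hx')]
  · rw [intervalIntegrable_iff_integrableOn_Icc_of_le hle]
    refine Measure.integrableOn_of_bounded (M := C) (by simp)
      ((measurable_diagonalDensity hk).comp measurable_prodMk_right).aestronglyMeasurable ?_
    refine (ae_restrict_iff' measurableSet_Icc).mpr (.of_forall fun s hs => ?_)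
    exact hC s ⟨hs.1, hs.2.trans hr.2⟩ τ hτ

/-- The symmetrized triangular kernel as a composition of two bounded kernels. -/
theorem setIntegral_ite_mul_ite_diagonalDensity {k : ℝ × ℝ → ℝ} (hk : ContDiff ℝ 1 k) {t : ℝ}
    (ht : t ∈ Set.Icc (0 : ℝ) 1) (p : ℝ × ℝ) :
    ∫ s in Set.Icc (-1) t, (if s ≤ p.1 ∧ p.1 ∈ Set.Icc 0 t then (1 : ℝ) else 0) *
        (if s ∈ Set.Icc (-1) t ∧ p.2 ∈ Set.Icc 0 t then diagonalDensity k s p.2 else 0)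
      = (Set.Icc 0 t ×ˢ Set.Icc 0 t).indicator
        (fun p => k (min p.1 p.2, max p.1 p.2)) p := by
  obtain ⟨r, τ⟩ := p
  by_cases hp : r ∈ Set.Icc 0 t ∧ τ ∈ Set.Icc 0 t
  · obtain ⟨hr, hτ⟩ := hp
    have hrt : Set.Icc (-1) t ∩ Set.Iic r = Set.Icc (-1) r := by
      ext s
      simp only [Set.mem_inter_iff, Set.mem_Icc, Set.mem_Iic]
      exact ⟨fun h => ⟨h.1.1, h.2⟩, fun h => ⟨⟨h.1, h.2.trans hr.2⟩, h.2⟩⟩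
    have hcongr : ∫ s in Set.Icc (-1) t, (if s ≤ r ∧ r ∈ Set.Icc 0 t then (1 : ℝ) else 0) *
        (if s ∈ Set.Icc (-1) t ∧ τ ∈ Set.Icc 0 t then diagonalDensity k s τ else 0)
        = ∫ s in Set.Icc (-1) t, (Set.Iic r).indicator (fun s => diagonalDensity k s τ) s := by
      refine setIntegral_congr_fun measurableSet_Icc fun s hs => ?_
      simp [hs, hr, hτ, Set.indicator_apply]
    rw [hcongr, setIntegral_indicator measurableSet_Iic, hrt, integral_Icc_eq_integral_Ioc,
      ← intervalIntegral.integral_of_le (by linarith [hr.1]),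
      integral_diagonalDensity hk ⟨hr.1, hr.2.trans ht.2⟩ ⟨hτ.1, hτ.2.trans ht.2⟩,
      Set.indicator_of_mem (Set.mk_mem_prod hr hτ)]
  · rw [Set.indicator_of_notMem (by simpa only [Set.mem_prod] using hp)]
    refine integral_eq_zero_of_ae (.of_forall fun s => ?_)
    rw [not_and_or] at hp
    rcases hp with h | h <;> simp only [h, and_false, if_false, zero_mul, mul_zero, Pi.zero_apply]

theorem HilbertBasis.hasSum_double_integrals {ι : Type*}
    (V : HilbertBasis ι ℝ (Lp ℝ 2 (volume.restrict (Set.Icc (0 : ℝ) 1))))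
    {k : ℝ × ℝ → ℝ} (hk : ContDiff ℝ 1 k) {t : ℝ} (ht : t ∈ Set.Icc (0 : ℝ) 1) :
    HasSum (fun i : ι => ∫ p in Set.Icc (0 : ℝ) t ×ˢ Set.Icc (0 : ℝ) t,
        (if p.1 ≤ p.2 then k p else 0) * V i p.1 * V i p.2)
      ((1 / 2) * ∫ τ in (0 : ℝ)..t, k (τ, τ)) := by
  have : Fact ((2 : ENNReal) ≠ ⊤) := ⟨ENNReal.ofNat_ne_top⟩
  have : Countable ι := V.orthonormal.countable_of_separableSpace
  have hc : Continuous k := hk.continuous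
  have hIcc : Set.Icc (0 : ℝ) t ⊆ Set.Icc 0 1 := Set.Icc_subset_Icc_right ht.2
  obtain ⟨C, hC⟩ := exists_abs_diagonalDensity_le hk
  have hC0 : 0 ≤ C := (abs_nonneg _).trans (hC 0 (by simp) 0 (by simp))
  have h := V.hasSum_integral_kernel (ν := volume.restrict (Set.Icc (-1) t))
    (F := fun s r => if s ≤ r ∧ r ∈ Set.Icc 0 t then 1 else 0)
    (G := fun s τ => if s ∈ Set.Icc (-1) t ∧ τ ∈ Set.Icc 0 t then diagonalDensity k s τ else 0)
    (A := 1) (B := C) ?_ ?_ ?_ ?_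
  · simp only [setIntegral_ite_mul_ite_diagonalDensity hk ht] at h
    have hdiag (x : ℝ) := setIntegral_ite_mul_ite_diagonalDensity hk ht (x, x)
    simp only at hdiag
    simp only [hdiag] at h
    convert! h.mul_left (1 / 2) using 2 with i
    · have hint : Integrable (fun p : ℝ × ℝ => (if p.1 ≤ p.2 then k p else 0) * V i p.1 * V i p.2)
          ((volume.restrict (Set.Icc 0 t)).prod (volume.restrict (Set.Icc 0 t))) := by
        have hV : Integrable (V i) (volume.restrict (Set.Icc 0 t)) :=
          IntegrableOn.mono_set (t := Set.Icc 0 1)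
            ((Lp.memLp (V i)).integrable one_le_two) hIcc
        obtain ⟨M, hM⟩ := (isCompact_Icc.prod isCompact_Icc).exists_bound_of_continuousOn
          (s := Set.Icc (0 : ℝ) t ×ˢ Set.Icc (0 : ℝ) t) hc.continuousOn
        simp_rw [mul_assoc]
        refine (hV.mul_prod hV).bdd_mul (c := M) ?_ ?_
        · exact (Measurable.ite (measurableSet_le measurable_fst measurable_snd) hc.measurable
            measurable_const).aestronglyMeasurable
        · rw [Measure.prod_restrict]
          refine (ae_restrict_iff' (measurableSet_Icc.prod measurableSet_Icc)).mpr
            (.of_forall fun p hp => ?_)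
          split_ifs
          · exact hM p hp
          · simpa using (norm_nonneg _).trans (hM p hp)
      have hhalf := integral_upper_triangle_mul_eq_half hint
      rw [Measure.prod_restrict, ← Measure.volume_eq_prod] at hhalf
      rw [hhalf, Measure.prod_restrict, ← Measure.volume_eq_prod]
      simp_rw [← Set.indicator_mul_left (Set.Icc (0 : ℝ) t ×ˢ Set.Icc (0 : ℝ) t)
        (fun p : ℝ × ℝ => k (min p.1 p.2, max p.1 p.2)) (fun p : ℝ × ℝ => V i p.1 * V i p.2)]
      rw [setIntegral_indicator (measurableSet_Icc.prod measurableSet_Icc),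
        Set.inter_eq_self_of_subset_right (Set.prod_mono hIcc hIcc)]
    · have hind (x : ℝ) : (Set.Icc 0 t ×ˢ Set.Icc 0 t).indicator
          (fun p : ℝ × ℝ => k (min p.1 p.2, max p.1 p.2)) (x, x)
          = (Set.Icc 0 t).indicator (fun x => k (x, x)) x := by
        simp [Set.indicator_apply]
      simp_rw [hind]
      rw [setIntegral_indicator measurableSet_Icc, Set.inter_eq_self_of_subset_right hIcc,
        intervalIntegral.integral_of_le ht.1, integral_Icc_eq_integral_Ioc]
  · exact Measurable.ite ((measurableSet_le measurable_fst measurable_snd).inter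
      (measurable_snd measurableSet_Icc)) measurable_const measurable_const
  · exact Measurable.ite ((measurable_fst measurableSet_Icc).inter
      (measurable_snd measurableSet_Icc)) (measurable_diagonalDensity hk) measurable_const
  · intro s r
    split_ifs <;> simp
  · intro s τ
    split_ifs with hs
    · exact hC s ⟨hs.1.1, hs.1.2.trans ht.2⟩ τ (hIcc hs.2)
    · simpa using hC0

/-- Lemma 8.12, scalar form. For `k : ℝ × ℝ → ℝ` twice continuously
differentiable, any Hilbert basis `(V_i)` of `L²([0,1], ℝ)` and `t ∈ [0,1]`, the family
`∫_{[0,t]²} 1_{r ≤ τ} k(r,τ) V_i(r) V_i(τ) dr dτ` is summable with sum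
`(1/2) ∫₀^t k(τ,τ) dτ`. -/
theorem sum_double_integrals_eq_half_diagonal
    (ι : Type*)
    (V : HilbertBasis ι ℝ (Lp ℝ 2 (volume.restrict (Set.Icc (0 : ℝ) 1))))
    (k : ℝ × ℝ → ℝ) (hk : ContDiff ℝ 2 k)
    (t : ℝ) (ht : t ∈ Set.Icc (0 : ℝ) 1) :
    Summable (fun i : ι => ∫ p in Set.Icc (0 : ℝ) t ×ˢ Set.Icc (0 : ℝ) t,
        (if p.1 ≤ p.2 then k p else 0) * V i p.1 * V i p.2) ∧
    ∑' i : ι, ∫ p in Set.Icc (0 : ℝ) t ×ˢ Set.Icc (0 : ℝ) t,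
        (if p.1 ≤ p.2 then k p else 0) * V i p.1 * V i p.2
      = (1 / 2) * ∫ τ in (0 : ℝ)..t, k (τ, τ) := by
  have h := V.hasSum_double_integrals (hk.of_le one_le_two) ht
  exact ⟨h.summable, h.tsum_eq⟩
end
end

section
/- Let n ≥ 1, let A, B : ℝ → Matrix(n, n, ℝ) be continuous, and let x : ℝ × ℝ → Matrix(n, n, ℝ) be twice continuously differentiable with x(0, σ) = I for all σ and ∂x/∂τ(τ, σ) = x(τ, σ)·(A(τ) + σ·B(τ)) for all τ, σ. Assume x(τ, 0) is invertible for every τ. Then for every τ, ∂x/∂σ(τ, 0) = h(τ)·x(τ, 0), where h(τ) = ∫_0^τ x(ρ, 0)·B(ρ)·x(ρ, 0)^{-1} dρ. -/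
open MeasureTheory Matrix

attribute [local instance] Matrix.normedAddCommGroup Matrix.normedSpace

noncomputable section

/-- Global solutions of a linear inhomogeneous differential equation with continuous coefficients
are determined by their value at one time. -/
theorem linearODE_solution_unique {E : Type*} [NormedAddCommGroup E] [NormedSpace ℝ E]
    {L : ℝ → E →L[ℝ] E} (hL : Continuous L) {c f g : ℝ → E} {t₀ : ℝ}
    (hf : ∀ t, HasDerivAt f (L t (f t) + c t) t) (hg : ∀ t, HasDerivAt g (L t (g t) + c t) t)
    (h₀ : f t₀ = g t₀) : f = g := by
  funext t
  obtain ⟨a, ha⟩ := exists_lt (min t₀ t)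
  obtain ⟨b, hb⟩ := exists_gt (max t₀ t)
  rw [lt_min_iff] at ha
  rw [max_lt_iff] at hb
  obtain ⟨K, hK⟩ := (isCompact_Icc (a := a) (b := b)).bddAbove_image hL.nnnorm.continuousOn
  refine ODE_solution_unique_of_mem_Ioo (v := fun t y => L t y + c t) (s := fun _ => Set.univ)
    (K := K) (fun s hs => ?_) ⟨ha.1, hb.1⟩ (fun s _ => ⟨hf s, trivial⟩)
    (fun s _ => ⟨hg s, trivial⟩) h₀ ⟨ha.2, hb.2⟩
  refine LipschitzWith.lipschitzOnWith (LipschitzWith.of_dist_le_mul fun y z => ?_)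
  rw [dist_add_right]
  exact ((L s).lipschitz.weaken
    (hK (Set.mem_image_of_mem _ (Set.Ioo_subset_Icc_self hs)))).dist_le_mul y z

/-- Mixed partial derivatives of a twice continuously differentiable `f` along two curves through
the same point: if `∂f/∂u = g` along a curve with velocity `v`, then `∂f/∂v` has along a curve with
velocity `u` the derivative of `g`. -/
theorem ContDiff.hasDerivAt_fderiv_apply_comm {E F : Type*} [NormedAddCommGroup E]
    [NormedSpace ℝ E] [NormedAddCommGroup F] [NormedSpace ℝ F] {f : E → F} {g : ℝ → F}
    (hf : ContDiff ℝ 2 f) {γ δ : ℝ → E} {s t : ℝ} {u v : E} {w : F} (hγ : HasDerivAt γ u s)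
    (hδ : HasDerivAt δ v t) (hst : γ s = δ t)
    (hg : ∀ r, fderiv ℝ f (δ r) u = g r) (hw : HasDerivAt g w t) :
    HasDerivAt (fun r => fderiv ℝ f (γ r) v) w s := by
  have hd : Differentiable ℝ (fderiv ℝ f) :=
    (hf.fderiv_right (m := 1) (by norm_num)).differentiable (by norm_num)
  have hsymm : IsSymmSndFDerivAt ℝ f (δ t) :=
    hf.contDiffAt.isSymmSndFDerivAt (by simp)
  have hw' := ((hd (δ t)).hasFDerivAt.comp_hasDerivAt t hδ).clm_apply (hasDerivAt_const t u)
  have hs' := ((hd (γ s)).hasFDerivAt.comp_hasDerivAt s hγ).clm_apply (hasDerivAt_const s v)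
  simp only [Function.comp_apply, map_zero, add_zero, hg] at hw' hs'
  rw [hw.unique hw', hsymm, ← hst]
  exact hs'

section MatrixCalculus

variable {m : Type*} [Fintype m]

/-- Matrix multiplication as a continuous bilinear map. -/
def Matrix.mulCLM (m : Type*) [Fintype m] :
    Matrix m m ℝ →L[ℝ] Matrix m m ℝ →L[ℝ] Matrix m m ℝ :=
  (LinearMap.mul ℝ (Matrix m m ℝ)).toContinuousBilinearMap

theorem HasDerivAt.matrix_mul {M N : ℝ → Matrix m m ℝ} {M' N' : Matrix m m ℝ} {t : ℝ}
    (hM : HasDerivAt M M' t) (hN : HasDerivAt N N' t) :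
    HasDerivAt (fun s => M s * N s) (M t * N' + M' * N t) t :=
  (Matrix.mulCLM m).hasDerivAt_of_bilinear (fun _ => hM) fun _ => hN

theorem Continuous.matrix_inv [DecidableEq m] {X : Type*} [TopologicalSpace X]
    {M : X → Matrix m m ℝ} (hM : Continuous M) (hu : ∀ a, IsUnit (M a)) :
    Continuous fun a => (M a)⁻¹ := by
  simp only [Matrix.inv_def, Ring.inverse_eq_inv']
  exact (hM.matrix_det.inv₀ fun a => ((Matrix.isUnit_iff_isUnit_det _).1 (hu a)).ne_zero).smul
    hM.matrix_adjugate

end MatrixCalculus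

/-- formula (8.1): the differential of the Itô map. Let
`x(τ, σ)` solve `∂x/∂τ = x·(A(τ) + σB(τ))`, `x(0, σ) = I`, with `x(τ, 0)` invertible.
Then `∂x/∂σ(τ, 0) = h(τ)·x(τ, 0)` where `h(τ) = ∫₀^τ x(ρ,0) B(ρ) x(ρ,0)⁻¹ dρ`. -/
theorem ito_map_differential
    (n : ℕ) (hn : 1 ≤ n)
    (A B : ℝ → Matrix (Fin n) (Fin n) ℝ) (hA : Continuous A) (hB : Continuous B)
    (x : ℝ × ℝ → Matrix (Fin n) (Fin n) ℝ) (hx : ContDiff ℝ 2 x)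
    (hx0 : ∀ σ : ℝ, x (0, σ) = 1)
    (hxτ : ∀ τ σ : ℝ, fderiv ℝ x (τ, σ) (1, 0) = x (τ, σ) * (A τ + σ • B τ))
    (hinv : ∀ τ : ℝ, IsUnit (x (τ, 0))) :
    ∀ τ : ℝ, fderiv ℝ x (τ, 0) (0, 1)
      = (∫ ρ in (0 : ℝ)..τ, x (ρ, 0) * B ρ * (x (ρ, 0))⁻¹) * x (τ, 0) := by
  have hd : Differentiable ℝ x := hx.differentiable (by norm_num)
  have hrow (τ σ : ℝ) : HasDerivAt (fun t : ℝ => (t, σ)) ((1 : ℝ), (0 : ℝ)) τ :=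
    (hasDerivAt_id τ).prodMk (hasDerivAt_const τ σ)
  have hcol (τ σ : ℝ) : HasDerivAt (fun s : ℝ => (τ, s)) ((0 : ℝ), (1 : ℝ)) σ :=
    (hasDerivAt_const σ τ).prodMk (hasDerivAt_id σ)
  have hX (τ : ℝ) : HasDerivAt (fun t => x (t, 0)) (x (τ, 0) * A τ) τ := by
    have h := (hd (τ, 0)).hasFDerivAt.comp_hasDerivAt τ (hrow τ 0)
    exact h.congr_deriv ((hxτ τ 0).trans (by rw [zero_smul, add_zero]))
  have hXσ (τ σ : ℝ) : HasDerivAt (fun s => x (τ, s)) (fderiv ℝ x (τ, σ) (0, 1)) σ :=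
    (hd (τ, σ)).hasFDerivAt.comp_hasDerivAt σ (hcol τ σ)
  have hv (τ : ℝ) : HasDerivAt (fun t => fderiv ℝ x (t, 0) (0, 1))
      (fderiv ℝ x (τ, 0) (0, 1) * A τ + x (τ, 0) * B τ) τ := by
    refine hx.hasDerivAt_fderiv_apply_comm (hrow τ 0) (hcol τ 0) rfl (hxτ τ) ?_
    have hAB : HasDerivAt (fun s : ℝ => A τ + s • B τ) (B τ) 0 :=
      (((hasDerivAt_id (0 : ℝ)).smul_const (B τ)).const_add (A τ)).congr_deriv
        (one_smul ℝ (B τ))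
    have h := (hXσ τ 0).matrix_mul hAB
    rwa [zero_smul, add_zero, add_comm] at h
  have hXc : Continuous fun τ : ℝ => x (τ, 0) := hx.continuous.comp (by fun_prop)
  have hint : Continuous fun ρ : ℝ => x (ρ, 0) * B ρ * (x (ρ, 0))⁻¹ :=
    (hXc.mul hB).mul (hXc.matrix_inv hinv)
  have hw (τ : ℝ) : HasDerivAt
      (fun t => (∫ ρ in (0 : ℝ)..t, x (ρ, 0) * B ρ * (x (ρ, 0))⁻¹) * x (t, 0))
      ((∫ ρ in (0 : ℝ)..τ, x (ρ, 0) * B ρ * (x (ρ, 0))⁻¹) * x (τ, 0) * A τ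
        + x (τ, 0) * B τ) τ := by
    have h := (hint.integral_hasStrictDerivAt 0 τ).hasDerivAt.matrix_mul (hX τ)
    rwa [Matrix.mul_assoc (x (τ, 0) * B τ), Matrix.nonsing_inv_mul _
      ((Matrix.isUnit_iff_isUnit_det _).1 (hinv τ)), Matrix.mul_one, ← Matrix.mul_assoc] at h
  have hv0 : fderiv ℝ x (0, 0) (0, 1) = 0 := by
    refine (hXσ 0 0).unique ?_
    simp only [hx0]
    exact hasDerivAt_const _ _
  refine congrFun (linearODE_solution_unique (t₀ := 0)
    (L := fun t => (Matrix.mulCLM (Fin n)).flip (A t)) (c := fun t => x (t, 0) * B t)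
    ((Matrix.mulCLM (Fin n)).flip.continuous.comp hA) hv hw ?_)
  simp [hv0]
end
end
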